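/- arXiv:2004.05252 — 2 statements merged into one kernel-verified Lean document; each statement's English description precedes it below -/
import Mathlib

section
/- Let A ⊆ B ⊆ {1,…,N} with |A| ≥ γ·N, let γ ∈ (1/2, 1], ℓ ∈ (0, 2·arccos((1−γ)/γ)), κ > D(Ω_B)/(γ·sin ℓ − 2(1−γ)·sin(ℓ/2)), and assume additionally D(Ω_B)/κ < ((2γ−1)^{3/2}/√(2γ))·((2−γ)/(√(γ/2)+(1−γ))). Let θ be a Kuramoto solution with D(Θ_A(0)) ≤ ℓ, and let φ₁ be the unique solution of γ·sin φ − 2(1−γ)·sin(φ/2) = D(Ω_B)/κ in [0, θ*] with θ* := 2·arccos((1−γ+√((1−γ)²+8γ²))/(4γ)). Then the oscillators of Θ_A become ordered according to their natural frequencies: for all i, j ∈ A, (a) if ν_i > ν_j then (ν_i−ν_j)/κ ≤ liminf_{t→∞}(θ_i(t)−θ_j(t)) ≤ limsup_{t→∞}(θ_i(t)−θ_j(t)) ≤ (π/(2√2·(γ·cos φ₁ − (1−γ))))·((ν_i−ν_j)/κ); (b) if ν_i = ν_j then lim_{t→∞}(θ_i(t)−θ_j(t)) = 0. -/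
/-- A Kuramoto solution on `[0,∞)` (modeled as a function on ℝ whose ODE holds on `Set.Ici 0`). -/
def IsKuramotoOn {N : ℕ} (κ : ℝ) (ν : Fin N → ℝ) (θ : ℝ → Fin N → ℝ) : Prop :=
  ∀ (i : Fin N), ∀ t ∈ Set.Ici (0 : ℝ), HasDerivWithinAt (fun s => θ s i)
    (ν i + κ / N * ∑ j, Real.sin (θ t j - θ t i)) (Set.Ici 0) t

/-- Diameter of a sub-ensemble: `max_{i,j ∈ A} |x i - x j|`. -/
noncomputable def diam {N : ℕ} (A : Finset (Fin N)) (x : Fin N → ℝ) : ℝ :=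
  sSup {d : ℝ | ∃ i ∈ A, ∃ j ∈ A, d = |x i - x j|}

open Set Filter Topology

/-- A finite family of functions stays below a barrier `B` provided that, whenever the whole family
lies below `B`, each member touching `B` grows strictly slower than `B`. -/
lemma le_barrier_of_deriv_lt_at_contact {ι : Type*} [Finite ι] {g g' : ι → ℝ → ℝ}
    {B B' : ℝ → ℝ} {a : ℝ}
    (hg : ∀ p, ∀ t ∈ Ici a, HasDerivWithinAt (g p) (g' p t) (Ici a) t)
    (hB : ∀ t, HasDerivAt B (B' t) t) (h0 : ∀ p, g p a ≤ B a)
    (hc : ∀ t ∈ Ici a, (∀ q, g q t ≤ B t) → ∀ p, g p t = B t → g' p t < B' t) :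
    ∀ t ∈ Ici a, ∀ p, g p t ≤ B t := by
  intro b hb
  have hBc : Continuous B := continuous_iff_continuousAt.2 fun t => (hB t).continuousAt
  have hgc : ∀ p, ContinuousOn (g p) (Icc a b) := fun p t ht =>
    ((hg p t ht.1).continuousWithinAt).mono Icc_subset_Ici_self
  have hclosed : IsClosed ({t | ∀ p, g p t ≤ B t} ∩ Icc a b) := by
    have : {t | ∀ p, g p t ≤ B t} ∩ Icc a b = Icc a b ∩ ⋂ p, {t ∈ Icc a b | g p t ≤ B t} := by
      ext t
      simp only [mem_inter_iff, mem_ofPred_eq, mem_iInter]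
      exact ⟨fun h => ⟨h.2, fun p => ⟨h.2, h.1 p⟩⟩, fun h => ⟨fun p => (h.2 p).2, h.1⟩⟩
    rw [this]
    exact isClosed_Icc.inter
      (isClosed_iInter fun p => isClosed_Icc.isClosed_le (hgc p) hBc.continuousOn)
  refine hclosed.Icc_subset_of_forall_exists_gt h0 ?_ (right_mem_Icc.2 hb)
  rintro x ⟨hx, hxa, hxb⟩ y hy
  have key : ∀ᶠ z in 𝓝[>] x, ∀ p, g p z ≤ B z := by
    rw [eventually_all]
    intro p
    have hd : HasDerivWithinAt (fun z => g p z - B z) (g' p x - B' x) (Ioi x) x :=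
      ((hg p x hxa).mono fun z hz => le_trans hxa (le_of_lt hz)).sub (hB x).hasDerivWithinAt
    rcases (hx p).lt_or_eq with hlt | heq
    · have h := hd.continuousWithinAt.tendsto.eventually (gt_mem_nhds (sub_neg.2 hlt))
      filter_upwards [h] with z hz
      linarith
    · have h := hd.limsup_slope_le' (by simp) (sub_neg.2 (hc x hxa hx p heq))
      filter_upwards [h, self_mem_nhdsWithin] with z hz hxz
      have hxz' : 0 < z - x := sub_pos.2 hxz
      rw [slope_def_field, div_lt_iff₀ hxz'] at hz
      linarith
  obtain ⟨z, hz, hz'⟩ := (key.and (Ioc_mem_nhdsGT hy)).exists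
  exact ⟨z, hz, hz'⟩

/-- A function decreasing at a uniform rate whenever it is above `c` is eventually below any
`c' > c`. -/
lemma eventually_lt_of_deriv_le_neg {g g' : ℝ → ℝ} {a c c' μ : ℝ} (hμ : 0 < μ) (hc : c < c')
    (hg : ∀ t ∈ Ici a, HasDerivWithinAt g (g' t) (Ici a) t)
    (h : ∀ᶠ t in atTop, c ≤ g t → g' t ≤ -μ) : ∀ᶠ t in atTop, g t < c' := by
  obtain ⟨T, hTa, hT⟩ : ∃ T, a ≤ T ∧ ∀ t ∈ Ici T, c ≤ g t → g' t ≤ -μ := by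
    obtain ⟨T, hT⟩ := eventually_atTop.1 h
    exact ⟨max a T, le_max_left _ _, fun t ht => hT t ((le_max_right _ _).trans ht)⟩
  obtain ⟨L, hL, hgL⟩ : ∃ L, 0 < L ∧ g T ≤ c + L :=
    ⟨max 1 (g T - c), by positivity, by linarith [le_max_right 1 (g T - c)]⟩
  set r := μ / (2 * L) with hr
  have hr0 : 0 < r := by positivity
  have hrL : r * L = μ / 2 := by rw [hr]; field_simp
  have hB : ∀ t, HasDerivAt (fun t => c + L * Real.exp (-r * (t - T)))
      (L * (Real.exp (-r * (t - T)) * (-r * 1))) t := fun t =>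
    (((((hasDerivAt_id t).sub_const T).const_mul (-r)).exp).const_mul L).const_add c
  have hle := le_barrier_of_deriv_lt_at_contact (ι := Unit) (g := fun _ => g) (g' := fun _ => g')
    (a := T) (fun _ t ht => (hg t (hTa.trans ht)).mono (Ici_subset_Ici.2 hTa)) hB
    (fun _ => by simpa using hgL) (by
      intro t ht _ _ heq
      have hpos := Real.exp_pos (-r * (t - T))
      have hle1 : Real.exp (-r * (t - T)) ≤ 1 := by
        rw [Real.exp_le_one_iff]
        nlinarith [mem_Ici.1 ht]
      have h1 := hT t ht (by rw [heq]; nlinarith [mul_pos hL hpos])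
      have h2 : L * (Real.exp (-r * (t - T)) * (-r * 1)) = -(μ / 2 * Real.exp (-r * (t - T))) := by
        rw [← hrL]; ring
      rw [h2]
      nlinarith)
  have hlim : Tendsto (fun t => c + L * Real.exp (-r * (t - T))) atTop (𝓝 (c + L * 0)) := by
    refine (Tendsto.const_mul L (Real.tendsto_exp_atBot.comp ?_)).const_add c
    exact (tendsto_atTop_add_const_right _ (-T) tendsto_id).const_mul_atTop_of_neg (by linarith)
  filter_upwards [hlim.eventually (gt_mem_nhds (by simpa using hc)), eventually_ge_atTop T]
    with t ht htT
  exact (hle t htT ()).trans_lt ht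

lemma abs_sub_le_diam {N : ℕ} {A : Finset (Fin N)} (x : Fin N → ℝ) {i j : Fin N}
    (hi : i ∈ A) (hj : j ∈ A) : |x i - x j| ≤ diam A x := by
  refine le_csSup (Set.Finite.bddAbove ?_) ⟨i, hi, j, hj, rfl⟩
  refine (Set.finite_range fun p : Fin N × Fin N => |x p.1 - x p.2|).subset ?_
  rintro d ⟨i, -, j, -, rfl⟩
  exact ⟨(i, j), rfl⟩

/-- Lower bound on the mean of cosines when a majority of them is at least `m`. -/
lemma majority_mean_cos_ge {N : ℕ} (hN : 1 ≤ N) {γ m : ℝ} {A : Finset (Fin N)}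
    (hcard : γ * N ≤ (A.card : ℝ)) (hm : -1 ≤ m) {x : Fin N → ℝ}
    (hx : ∀ k ∈ A, m ≤ Real.cos (x k)) :
    γ * m - (1 - γ) ≤ (N : ℝ)⁻¹ * ∑ k, Real.cos (x k) := by
  have hN0 : (0 : ℝ) < N := by exact_mod_cast hN
  have h1 : ∑ k, ((if k ∈ A then m + 1 else 0) - 1) ≤ ∑ k, Real.cos (x k) := by
    refine Finset.sum_le_sum fun k _ => ?_
    split_ifs with hk
    · linarith [hx k hk]
    · linarith [Real.neg_one_le_cos (x k)]
  have h2 : ∑ k : Fin N, ((if k ∈ A then m + 1 else 0) - 1) = A.card * (m + 1) - N := by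
    simp [Finset.sum_sub_distrib, Finset.sum_ite_mem, mul_add]
  rw [inv_mul_eq_div, le_div_iff₀ hN0]
  nlinarith

lemma mean_cos_le_one {N : ℕ} (hN : 1 ≤ N) (x : Fin N → ℝ) :
    (N : ℝ)⁻¹ * ∑ k, Real.cos (x k) ≤ 1 := by
  have hN0 : (0 : ℝ) < N := by exact_mod_cast hN
  rw [inv_mul_eq_div, div_le_one hN0]
  calc ∑ k, Real.cos (x k) ≤ ∑ _k : Fin N, (1 : ℝ) :=
        Finset.sum_le_sum fun k _ => Real.cos_le_one _
    _ = N := by simp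

/-- The equation satisfied by a phase difference. -/
lemma IsKuramotoOn.hasDerivWithinAt_sub {N : ℕ} {κ : ℝ} {ν : Fin N → ℝ} {θ : ℝ → Fin N → ℝ}
    (hθ : IsKuramotoOn κ ν θ) (i j : Fin N) {t : ℝ} (ht : t ∈ Ici (0 : ℝ)) :
    HasDerivWithinAt (fun s => θ s i - θ s j)
      (ν i - ν j - 2 * κ * Real.sin ((θ t i - θ t j) / 2) *
        ((N : ℝ)⁻¹ * ∑ k, Real.cos (θ t k - (θ t i + θ t j) / 2))) (Ici 0) t := by
  refine ((hθ i t ht).fun_sub (hθ j t ht)).congr_deriv ?_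
  have hsum : ∑ k, Real.sin (θ t k - θ t i) - ∑ k, Real.sin (θ t k - θ t j) =
      -2 * Real.sin ((θ t i - θ t j) / 2) * ∑ k, Real.cos (θ t k - (θ t i + θ t j) / 2) := by
    rw [← Finset.sum_sub_distrib, Finset.mul_sum]
    refine Finset.sum_congr rfl fun k _ => ?_
    rw [Real.sin_sub_sin, show (θ t k - θ t i - (θ t k - θ t j)) / 2 = -((θ t i - θ t j) / 2) by ring,
      show (θ t k - θ t i + (θ t k - θ t j)) / 2 = θ t k - (θ t i + θ t j) / 2 by ring, Real.sin_neg]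
    ring
  rw [div_eq_mul_inv]
  linear_combination (κ * (N : ℝ)⁻¹) * hsum

/-- The function controlling the contraction of a majority ensemble of ratio `γ`. -/
noncomputable def majorityForce (γ x : ℝ) : ℝ :=
  γ * Real.sin x - 2 * (1 - γ) * Real.sin (x / 2)

lemma majorityForce_eq (γ x : ℝ) : majorityForce γ x =
    2 * Real.sin (x / 2) * (γ * Real.cos (x / 2) - (1 - γ)) := by
  have h := Real.sin_two_mul (x / 2)
  rw [mul_div_cancel₀ _ (two_ne_zero' ℝ)] at h
  rw [majorityForce, h]
  ring

lemma hasDerivAt_majorityForce (γ x : ℝ) : HasDerivAt (majorityForce γ)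
    (2 * γ * Real.cos (x / 2) ^ 2 - (1 - γ) * Real.cos (x / 2) - γ) x := by
  have h1 := (Real.hasDerivAt_sin x).const_mul γ
  have h2 := (((hasDerivAt_id x).div_const 2).sin).const_mul (2 * (1 - γ))
  refine (h1.sub h2).congr_deriv ?_
  have h := Real.cos_two_mul (x / 2)
  rw [mul_div_cancel₀ _ (two_ne_zero' ℝ)] at h
  simp only [id]
  rw [h]
  ring

lemma le_cos_half_of_le_two_mul_arccos {u x : ℝ} (hu : -1 ≤ u) (hu' : u ≤ 1) (hx : 0 ≤ x)
    (hxu : x ≤ 2 * Real.arccos u) : u ≤ Real.cos (x / 2) := by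
  rw [← Real.cos_arccos hu hu']
  exact Real.cos_le_cos_of_nonneg_of_le_pi (by linarith) (Real.arccos_le_pi u) (by linarith)

lemma monotoneOn_majorityForce {γ : ℝ} (hγ₁ : 1 / 2 < γ) : MonotoneOn (majorityForce γ)
    (Icc 0 (2 * Real.arccos ((1 - γ + Real.sqrt ((1 - γ) ^ 2 + 8 * γ ^ 2)) / (4 * γ)))) := by
  set R := Real.sqrt ((1 - γ) ^ 2 + 8 * γ ^ 2) with hR
  have hR2 : R ^ 2 = (1 - γ) ^ 2 + 8 * γ ^ 2 := Real.sq_sqrt (by positivity)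
  have hR0 : 0 ≤ R := Real.sqrt_nonneg _
  have hRlow : |1 - γ| ≤ R := by
    rw [hR, ← Real.sqrt_sq_eq_abs]
    exact Real.sqrt_le_sqrt (by nlinarith)
  have hRγ : γ - 1 ≤ R := by linarith [neg_abs_le (1 - γ)]
  have hRup : R ≤ 5 * γ - 1 := by
    rw [hR]
    exact Real.sqrt_le_iff.2 ⟨by linarith, by nlinarith⟩
  have hγ0 : 0 < 4 * γ := by linarith
  refine monotoneOn_of_deriv_nonneg (convex_Icc _ _)
    (fun x _ => (hasDerivAt_majorityForce γ x).continuousAt.continuousWithinAt)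
    (fun x _ => (hasDerivAt_majorityForce γ x).differentiableAt.differentiableWithinAt) ?_
  intro x hx
  have hx := interior_subset hx
  have hu := le_cos_half_of_le_two_mul_arccos
    (le_trans (by norm_num) (div_nonneg (by linarith) hγ0.le))
    ((div_le_one hγ0).2 (by linarith)) hx.1 hx.2
  rw [(hasDerivAt_majorityForce γ x).deriv]
  rw [div_le_iff₀ hγ0] at hu
  nlinarith [abs_le.1 hRlow]

lemma concaveOn_majorityForce {γ : ℝ} (hγ₁ : 1 / 2 < γ) (hγ₂ : γ ≤ 1) :
    ConcaveOn ℝ (Icc 0 (2 * Real.arccos ((1 - γ) / γ))) (majorityForce γ) := by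
  have hγ0 : 0 < γ := by linarith
  refine AntitoneOn.concaveOn_of_deriv (convex_Icc _ _)
    (fun x _ => (hasDerivAt_majorityForce γ x).continuousAt.continuousWithinAt)
    (fun x _ => (hasDerivAt_majorityForce γ x).differentiableAt.differentiableWithinAt) ?_
  intro x hx y hy hxy
  have hx := interior_subset hx
  have hy := interior_subset hy
  have hq0 : 0 ≤ (1 - γ) / γ := div_nonneg (by linarith) hγ0.le
  have hq1 : (1 - γ) / γ ≤ 1 := (div_le_one hγ0).2 (by linarith)
  have hu := le_cos_half_of_le_two_mul_arccos (by linarith) hq1 hx.1 hx.2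
  have hv := le_cos_half_of_le_two_mul_arccos (by linarith) hq1 hy.1 hy.2
  have hvu : Real.cos (y / 2) ≤ Real.cos (x / 2) :=
    Real.cos_le_cos_of_nonneg_of_le_pi (by linarith [hx.1])
      (by linarith [hy.2, Real.arccos_le_pi ((1 - γ) / γ)]) (by linarith)
  rw [(hasDerivAt_majorityForce γ x).deriv, (hasDerivAt_majorityForce γ y).deriv]
  rw [div_le_iff₀ hγ0] at hu hv
  nlinarith [mul_nonneg (sub_nonneg.2 hvu)
    (show 0 ≤ 2 * γ * (Real.cos (x / 2) + Real.cos (y / 2)) - (1 - γ) by linarith)]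

/-- The value of `majorityForce γ` at the angle whose cosine is `(1 - γ) / γ`. -/
lemma majorityForce_arccos {γ : ℝ} (hγ₁ : 1 / 2 < γ) (hγ₂ : γ ≤ 1) :
    majorityForce γ (Real.arccos ((1 - γ) / γ)) =
      (2 * γ - 1) ^ ((3 : ℝ) / 2) / Real.sqrt (2 * γ) *
        ((2 - γ) / (Real.sqrt (γ / 2) + (1 - γ))) := by
  have hγ0 : 0 < γ := by linarith
  have hq0 : 0 ≤ (1 - γ) / γ := div_nonneg (by linarith) hγ0.le
  have hq1 : (1 - γ) / γ ≤ 1 := (div_le_one hγ0).2 (by linarith)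
  have hcos : Real.cos (Real.arccos ((1 - γ) / γ)) = (1 - γ) / γ :=
    Real.cos_arccos (by linarith) hq1
  have h0 := Real.arccos_nonneg ((1 - γ) / γ)
  have hpi := Real.arccos_le_pi ((1 - γ) / γ)
  have hsin : Real.sin (Real.arccos ((1 - γ) / γ) / 2) =
      Real.sqrt (2 * γ - 1) / Real.sqrt (2 * γ) := by
    rw [Real.sin_half_eq_sqrt h0 (by linarith), hcos, ← Real.sqrt_div (by linarith)]
    congr 1
    field_simp
    ring
  have hcos2 : γ * Real.cos (Real.arccos ((1 - γ) / γ) / 2) = Real.sqrt (γ / 2) := by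
    rw [Real.cos_half (by linarith) hpi, hcos]
    symm
    rw [Real.sqrt_eq_iff_mul_self_eq (by positivity) (by positivity),
      mul_mul_mul_comm, Real.mul_self_sqrt (by positivity)]
    field_simp
    ring
  have hpow : (2 * γ - 1) ^ ((3 : ℝ) / 2) = (2 * γ - 1) * Real.sqrt (2 * γ - 1) := by
    rw [show (3 : ℝ) / 2 = 1 + 1 / 2 by norm_num, Real.rpow_add (by linarith), Real.rpow_one,
      ← Real.sqrt_eq_rpow]
  have hs : Real.sqrt (γ / 2) ^ 2 = γ / 2 := Real.sq_sqrt (by positivity)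
  have hsp : 0 < Real.sqrt (γ / 2) := Real.sqrt_pos.2 (by positivity)
  have hden : Real.sqrt (γ / 2) + (1 - γ) ≠ 0 := by linarith
  have h2γ : Real.sqrt (2 * γ) ≠ 0 := (Real.sqrt_pos.2 (by positivity)).ne'
  rw [majorityForce_eq, hsin, hcos2, hpow]
  field_simp
  linear_combination 2 * Real.sqrt (2 * γ - 1) * hs

/-- A majority ensemble contracts exponentially fast towards diameter `φ₁`. -/
lemma exists_phase_sub_le_add_exp {N : ℕ} (hN : 1 ≤ N) {κ γ ℓ φ₁ : ℝ} (hκ : 0 < κ)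
    (hγ₁ : 1 / 2 < γ) (hγ₂ : γ ≤ 1)
    (hℓ : ℓ ≤ 2 * Real.arccos ((1 - γ) / γ)) {ν : Fin N → ℝ} {A : Finset (Fin N)}
    (hcard : γ * N ≤ (A.card : ℝ)) {θ : ℝ → Fin N → ℝ} (hθ : IsKuramotoOn κ ν θ)
    (h0 : ∀ i ∈ A, ∀ j ∈ A, θ 0 i - θ 0 j ≤ ℓ)
    (hφ₀ : 0 ≤ φ₁) (hφℓ : φ₁ < ℓ)
    (hν : ∀ i ∈ A, ∀ j ∈ A, ν i - ν j ≤ κ * majorityForce γ φ₁)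
    (hforce : majorityForce γ φ₁ < majorityForce γ ℓ) :
    ∃ r > 0, ∀ t ∈ Ici (0 : ℝ), ∀ i ∈ A, ∀ j ∈ A,
      θ t i - θ t j ≤ φ₁ + (ℓ - φ₁) * Real.exp (-r * t) := by
  have hγ0 : 0 < γ := by linarith
  have hq0 : 0 ≤ (1 - γ) / γ := div_nonneg (by linarith) hγ0.le
  have hℓπ : ℓ ≤ Real.pi := by linarith [Real.arccos_le_pi_div_two.2 hq0]
  set s := (majorityForce γ ℓ - majorityForce γ φ₁) / (ℓ - φ₁) with hs
  have hd : 0 < ℓ - φ₁ := sub_pos.2 hφℓ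
  have hs0 : 0 < s := div_pos (sub_pos.2 hforce) hd
  have hsd : s * (ℓ - φ₁) = majorityForce γ ℓ - majorityForce γ φ₁ := div_mul_cancel₀ _ hd.ne'
  set r := κ * s / 2 with hr
  have hr0 : 0 < r := by positivity
  have hB : ∀ t, HasDerivAt (fun t => φ₁ + (ℓ - φ₁) * Real.exp (-r * t))
      ((ℓ - φ₁) * (Real.exp (-r * t) * (-r * 1))) t := fun t =>
    ((((hasDerivAt_id t).const_mul (-r)).exp).const_mul _).const_add _
  refine ⟨r, hr0, fun t ht i hi j hj => ?_⟩
  refine le_barrier_of_deriv_lt_at_contact (ι := A × A)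
    (g := fun p t => θ t p.1 - θ t p.2) (fun p t ht => hθ.hasDerivWithinAt_sub p.1 p.2 ht) hB
    (fun p => by simpa using h0 p.1 p.1.2 p.2 p.2.2) ?_ t ht (⟨i, hi⟩, ⟨j, hj⟩)
  rintro t ht hall ⟨⟨i, hi⟩, ⟨j, hj⟩⟩ heq
  simp only at heq ⊢
  set e := Real.exp (-r * t) with he
  have he0 : 0 < e := Real.exp_pos _
  have he1 : e ≤ 1 := by
    rw [he, Real.exp_le_one_iff]
    nlinarith [mem_Ici.1 ht]
  set x := φ₁ + (ℓ - φ₁) * e with hx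
  have hx0 : 0 ≤ x := by positivity
  have hxℓ : x ≤ ℓ := by nlinarith
  have hfx : majorityForce γ φ₁ + s * (ℓ - φ₁) * e ≤ majorityForce γ x := by
    have hc := (concaveOn_majorityForce hγ₁ hγ₂).2 (mem_Icc.2 ⟨hφ₀, by linarith⟩)
      (mem_Icc.2 ⟨by linarith, hℓ⟩) (sub_nonneg.2 he1) he0.le (by ring)
    simp only [smul_eq_mul] at hc
    rw [show (1 - e) * φ₁ + e * ℓ = x by rw [hx]; ring] at hc
    rw [hsd]
    linarith
  have hmean := majority_mean_cos_ge hN hcard (Real.neg_one_le_cos (x / 2))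
    (x := fun k => θ t k - (θ t i + θ t j) / 2) (fun k hk => by
      have h1 := hall (⟨k, hk⟩, ⟨j, hj⟩)
      have h2 := hall (⟨i, hi⟩, ⟨k, hk⟩)
      simp only at h1 h2
      rw [← Real.cos_abs (θ t k - _)]
      exact Real.cos_le_cos_of_nonneg_of_le_pi (abs_nonneg _) (by linarith)
        (abs_le.2 ⟨by linarith, by linarith⟩))
  have hsin : 0 ≤ Real.sin (x / 2) :=
    Real.sin_nonneg_of_nonneg_of_le_pi (by linarith) (by linarith)
  have h1 := mul_le_mul_of_nonneg_left hmean (show 0 ≤ 2 * κ * Real.sin (x / 2) by positivity)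
  have h2 : 2 * κ * Real.sin (x / 2) * (γ * Real.cos (x / 2) - (1 - γ)) =
      κ * majorityForce γ x := by
    rw [majorityForce_eq]; ring
  have h3 := mul_le_mul_of_nonneg_left hfx hκ.le
  have h4 := hν i hi j hj
  have h5 : 0 < κ * (s * (ℓ - φ₁) * e) := by positivity
  have h6 : (ℓ - φ₁) * (e * (-r * 1)) = -(κ * (s * (ℓ - φ₁) * e)) / 2 := by rw [hr]; ring
  rw [heq, h6]
  linarith

/-- Chord bound for `sin` on `[0, π / 4]`. -/
lemma two_sqrt_two_div_pi_mul_le_two_sin_half {x : ℝ} (hx : 0 ≤ x) (hx' : x ≤ Real.pi / 2) :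
    2 * Real.sqrt 2 / Real.pi * x ≤ 2 * Real.sin (x / 2) := by
  have hpi := Real.pi_pos
  have hc := strictConcaveOn_sin_Icc.concaveOn.2 (left_mem_Icc.2 hpi.le)
    (show Real.pi / 4 ∈ Icc 0 Real.pi from ⟨by positivity, by linarith⟩)
    (show 0 ≤ 1 - 2 * x / Real.pi by rw [sub_nonneg, div_le_one hpi]; linarith)
    (show 0 ≤ 2 * x / Real.pi by positivity) (by ring)
  simp only [smul_eq_mul, Real.sin_zero, mul_zero, zero_add, Real.sin_pi_div_four] at hc
  rw [show 2 * x / Real.pi * (Real.pi / 4) = x / 2 by field_simp; ring] at hc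
  calc 2 * Real.sqrt 2 / Real.pi * x = 2 * (2 * x / Real.pi * (Real.sqrt 2 / 2)) := by ring
    _ ≤ _ := by linarith

lemma mean_cos_ge_of_phase_sub_le {N : ℕ} (hN : 1 ≤ N) {γ D : ℝ}
    {A : Finset (Fin N)} (hcard : γ * N ≤ (A.card : ℝ)) {x : Fin N → ℝ} (hD : D ≤ Real.pi)
    (hx : ∀ i ∈ A, ∀ j ∈ A, x i - x j ≤ D) {i j : Fin N} (hi : i ∈ A) (hj : j ∈ A) :
    γ * Real.cos D - (1 - γ) ≤ (N : ℝ)⁻¹ * ∑ k, Real.cos (x k - (x i + x j) / 2) := by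
  refine majority_mean_cos_ge hN hcard (Real.neg_one_le_cos D) fun k hk => ?_
  rw [← Real.cos_abs (x k - _)]
  refine Real.cos_le_cos_of_nonneg_of_le_pi (abs_nonneg _) hD (abs_le.2 ⟨?_, ?_⟩) <;>
    linarith [hx k hk i hi, hx k hk j hj, hx i hi k hk, hx j hj k hk]

/-- Eventual upper bound on a phase difference within a majority ensemble whose diameter is
asymptotically at most `φ₁`. -/
lemma eventually_phase_sub_lt {N : ℕ} (hN : 1 ≤ N) {κ γ φ₁ c : ℝ} (hκ : 0 < κ)
    {ν : Fin N → ℝ} {A : Finset (Fin N)}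
    (hcard : γ * N ≤ (A.card : ℝ)) {θ : ℝ → Fin N → ℝ} (hθ : IsKuramotoOn κ ν θ)
    (hφ₀ : 0 ≤ φ₁) (hφ : φ₁ < Real.pi / 2) (hpos : 0 < γ * Real.cos φ₁ - (1 - γ))
    (hD : ∀ φ > φ₁, ∀ᶠ t in atTop, ∀ i ∈ A, ∀ j ∈ A, θ t i - θ t j ≤ φ)
    {i j : Fin N} (hi : i ∈ A) (hj : j ∈ A) (hν : ν j ≤ ν i)
    (hc : Real.pi / (2 * Real.sqrt 2 * (γ * Real.cos φ₁ - (1 - γ))) * ((ν i - ν j) / κ) < c) :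
    ∀ᶠ t in atTop, θ t i - θ t j < c := by
  have hpi := Real.pi_pos
  have h2 : 0 < Real.sqrt 2 := by positivity
  obtain ⟨b, hKb, hbc⟩ := exists_between hc
  have hb0 : 0 < b := lt_of_le_of_lt
    (mul_nonneg (by positivity) (div_nonneg (sub_nonneg.2 hν) hκ.le)) hKb
  have hb : ν i - ν j < κ * (2 * Real.sqrt 2 / Real.pi) * (γ * Real.cos φ₁ - (1 - γ)) * b := by
    rw [div_mul_div_comm, div_lt_iff₀ (by positivity)] at hKb
    rw [← mul_lt_mul_iff_right₀ hpi]
    calc Real.pi * (ν i - ν j) < b * (2 * Real.sqrt 2 * (γ * Real.cos φ₁ - (1 - γ)) * κ) := hKb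
      _ = _ := by field_simp
  obtain ⟨φ, hφφ, hφ2, hφpos, hφb⟩ : ∃ φ > φ₁, φ < Real.pi / 2 ∧ 0 < γ * Real.cos φ - (1 - γ) ∧
      ν i - ν j < κ * (2 * Real.sqrt 2 / Real.pi) * (γ * Real.cos φ - (1 - γ)) * b := by
    have e1 : ∀ᶠ φ in 𝓝 φ₁, 0 < γ * Real.cos φ - (1 - γ) :=
      (by fun_prop : Continuous fun φ => γ * Real.cos φ - (1 - γ)).continuousAt.eventually
        (lt_mem_nhds hpos)
    have e2 : ∀ᶠ φ in 𝓝 φ₁,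
        ν i - ν j < κ * (2 * Real.sqrt 2 / Real.pi) * (γ * Real.cos φ - (1 - γ)) * b :=
      (by fun_prop : Continuous fun φ => κ * (2 * Real.sqrt 2 / Real.pi) *
        (γ * Real.cos φ - (1 - γ)) * b).continuousAt.eventually (lt_mem_nhds hb)
    have e := ((gt_mem_nhds hφ).and (e1.and e2)).filter_mono (nhdsWithin_le_nhds (s := Ioi φ₁))
    obtain ⟨φ, ⟨h1, h2, h3⟩, h4⟩ := (e.and self_mem_nhdsWithin).exists
    exact ⟨φ, h4, h1, h2, h3⟩
  refine eventually_lt_of_deriv_le_neg (sub_pos.2 hφb) hbc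
    (fun t ht => hθ.hasDerivWithinAt_sub i j ht) ?_
  filter_upwards [hD φ hφφ] with t ht hbt
  have hmean := mean_cos_ge_of_phase_sub_le hN hcard (by linarith) ht hi hj
  have hchord := two_sqrt_two_div_pi_mul_le_two_sin_half (hb0.le.trans hbt)
    ((ht i hi j hj).trans hφ2.le)
  have hchord' : 2 * Real.sqrt 2 / Real.pi * b ≤ 2 * Real.sin ((θ t i - θ t j) / 2) :=
    le_trans (by gcongr) hchord
  have h3 : 2 * Real.sqrt 2 / Real.pi * b * (γ * Real.cos φ - (1 - γ)) ≤
      2 * Real.sin ((θ t i - θ t j) / 2) *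
        ((N : ℝ)⁻¹ * ∑ k, Real.cos (θ t k - (θ t i + θ t j) / 2)) :=
    mul_le_mul hchord' hmean hφpos.le (le_trans (by positivity) hchord')
  linarith [mul_le_mul_of_nonneg_left h3 hκ.le]

/-- Eventual lower bound on a phase difference when the mean of cosines is nonnegative. -/
lemma eventually_lt_phase_sub {N : ℕ} (hN : 1 ≤ N) {κ c : ℝ} (hκ : 0 < κ) {ν : Fin N → ℝ}
    {θ : ℝ → Fin N → ℝ} (hθ : IsKuramotoOn κ ν θ) {i j : Fin N} (hν : ν j < ν i)
    (hsub : ∀ᶠ t in atTop, θ t j - θ t i ≤ Real.pi)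
    (hmean : ∀ᶠ t in atTop, 0 ≤ (N : ℝ)⁻¹ * ∑ k, Real.cos (θ t k - (θ t i + θ t j) / 2))
    (hc : c < (ν i - ν j) / κ) : ∀ᶠ t in atTop, c < θ t i - θ t j := by
  obtain ⟨b, hcb, hb⟩ := exists_between hc
  have hμ : 0 < min (ν i - ν j) (ν i - ν j - κ * b) := by
    rw [lt_div_iff₀ hκ] at hb
    exact lt_min (by linarith) (by linarith)
  have h := eventually_lt_of_deriv_le_neg hμ (neg_lt_neg hcb)
    (fun t ht => (hθ.hasDerivWithinAt_sub i j ht).fun_neg) (by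
      filter_upwards [hsub, hmean] with t hs hm hbt
      refine neg_le_neg ?_
      have hone := mean_cos_le_one hN fun k => θ t k - (θ t i + θ t j) / 2
      set C := (N : ℝ)⁻¹ * ∑ k, Real.cos (θ t k - (θ t i + θ t j) / 2)
      rcases le_or_gt 0 (θ t i - θ t j) with hΔ | hΔ
      · have h1 : Real.sin ((θ t i - θ t j) / 2) ≤ (θ t i - θ t j) / 2 := Real.sin_le (by linarith)
        have h2 : Real.sin ((θ t i - θ t j) / 2) * C ≤ (θ t i - θ t j) / 2 * 1 :=
          mul_le_mul h1 hone hm (by linarith)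
        have h3 := mul_le_mul_of_nonneg_left h2 hκ.le
        have h4 := mul_le_mul_of_nonneg_left (neg_le_neg_iff.1 hbt) hκ.le
        refine (min_le_right _ _).trans ?_
        linarith
      · have h1 : Real.sin ((θ t i - θ t j) / 2) ≤ 0 :=
          Real.sin_nonpos_of_nonpos_of_neg_pi_le (by linarith) (by linarith [Real.pi_pos])
        have h2 := mul_nonneg hκ.le (mul_nonneg (neg_nonneg.2 h1) hm)
        refine (min_le_left _ _).trans ?_
        linarith)
  filter_upwards [h] with t ht
  linarith

/-- Ordering of the majority ensemble according to natural frequencies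
(Theorem 3.1 (3)): under the stability conditions and the additional condition
`D(Ω_B)/κ < ((2γ−1)^{3/2}/√(2γ))·((2−γ)/(√(γ/2)+(1−γ)))`, for `i, j ∈ A`:
if `νᵢ > νⱼ` then `(νᵢ−νⱼ)/κ ≤ liminf (θᵢ−θⱼ) ≤ limsup (θᵢ−θⱼ)
≤ (π/(2√2(γ cos φ₁ −(1−γ))))·(νᵢ−νⱼ)/κ`; if `νᵢ = νⱼ` then `θᵢ−θⱼ → 0`. -/
theorem majority_ensemble_ordering (N : ℕ) (hN : 1 ≤ N) (κ γ ℓ : ℝ)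
    (hγ₁ : 1 / 2 < γ) (hγ₂ : γ ≤ 1)
    (hℓ : ℓ ∈ Set.Ioo 0 (2 * Real.arccos ((1 - γ) / γ)))
    (ν : Fin N → ℝ) (A B : Finset (Fin N)) (hAB : A ⊆ B)
    (hcard : γ * N ≤ (A.card : ℝ))
    (hκ : diam B ν / (γ * Real.sin ℓ - 2 * (1 - γ) * Real.sin (ℓ / 2)) < κ)
    (hadd : diam B ν / κ <
      (2 * γ - 1) ^ ((3 : ℝ) / 2) / Real.sqrt (2 * γ) *
        ((2 - γ) / (Real.sqrt (γ / 2) + (1 - γ))))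
    (θ : ℝ → Fin N → ℝ) (hθ : IsKuramotoOn κ ν θ)
    (h0 : diam A (θ 0) ≤ ℓ)
    (θs φ₁ : ℝ)
    (hθs : θs = 2 * Real.arccos ((1 - γ + Real.sqrt ((1 - γ) ^ 2 + 8 * γ ^ 2)) / (4 * γ)))
    (hφ₁mem : φ₁ ∈ Set.Icc 0 θs)
    (hφ₁root : γ * Real.sin φ₁ - 2 * (1 - γ) * Real.sin (φ₁ / 2) = diam B ν / κ) :
    ∀ i ∈ A, ∀ j ∈ A,
      (ν i > ν j →
        (ν i - ν j) / κ ≤ Filter.liminf (fun t => θ t i - θ t j) Filter.atTop ∧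
        Filter.limsup (fun t => θ t i - θ t j) Filter.atTop ≤
          Real.pi / (2 * Real.sqrt 2 * (γ * Real.cos φ₁ - (1 - γ))) *
            ((ν i - ν j) / κ)) ∧
      (ν i = ν j →
        Filter.Tendsto (fun t => θ t i - θ t j) Filter.atTop (nhds 0)) := by
  have hγ0 : 0 < γ := by linarith
  have hq0 : 0 ≤ (1 - γ) / γ := div_nonneg (by linarith) hγ0.le
  have hq1 : (1 - γ) / γ ≤ 1 := (div_le_one hγ0).2 (by linarith)
  have hq2 := Real.arccos_le_pi_div_two.2 hq0
  have hFℓ : 0 < majorityForce γ ℓ := by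
    rw [majorityForce_eq]
    have hsin : 0 < Real.sin (ℓ / 2) :=
      Real.sin_pos_of_pos_of_lt_pi (by linarith [hℓ.1]) (by linarith [hℓ.1, hℓ.2, Real.pi_pos])
    have hcos : (1 - γ) / γ < Real.cos (ℓ / 2) := by
      rw [← Real.cos_arccos (x := (1 - γ) / γ) (by linarith) hq1]
      exact Real.cos_lt_cos_of_nonneg_of_le_pi (by linarith [hℓ.1])
        (Real.arccos_le_pi _) (by linarith [hℓ.2])
    rw [div_lt_iff₀ hγ0] at hcos
    exact mul_pos (by linarith) (by linarith)
  intro i hi j hj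
  have hdiam : 0 ≤ diam B ν := (abs_nonneg _).trans (abs_sub_le_diam ν (hAB hi) (hAB hj))
  have hκ0 : 0 < κ := (div_nonneg hdiam hFℓ.le).trans_lt hκ
  change majorityForce γ φ₁ = _ at hφ₁root
  have hforce : majorityForce γ φ₁ < majorityForce γ ℓ := by
    rw [hφ₁root, div_lt_iff₀ hκ0]
    have := (div_lt_iff₀ hFℓ).1 hκ
    linarith
  rw [hθs] at hφ₁mem
  have hmono := monotoneOn_majorityForce hγ₁
  have hφℓ : φ₁ < ℓ := by
    by_contra! h
    exact hforce.not_ge (hmono ⟨hℓ.1.le, h.trans hφ₁mem.2⟩ hφ₁mem h)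
  have hφc : φ₁ < Real.arccos ((1 - γ) / γ) := by
    by_contra! h
    have := hmono ⟨Real.arccos_nonneg _, h.trans hφ₁mem.2⟩ hφ₁mem h
    rw [majorityForce_arccos hγ₁ hγ₂, hφ₁root] at this
    exact hadd.not_ge this
  have hφ2 : φ₁ < Real.pi / 2 := hφc.trans_le hq2
  have hcosφ : ∀ φ, 0 ≤ φ → φ < Real.arccos ((1 - γ) / γ) → 0 < γ * Real.cos φ - (1 - γ) := by
    intro φ hφ hφ'
    have h := Real.cos_lt_cos_of_nonneg_of_le_pi hφ (Real.arccos_le_pi _) hφ'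
    rw [Real.cos_arccos (by linarith) hq1, div_lt_iff₀ hγ0] at h
    linarith
  have hpos := hcosφ φ₁ hφ₁mem.1 hφc
  obtain ⟨r, hr, hexp⟩ := exists_phase_sub_le_add_exp hN hκ0 hγ₁ hγ₂ hℓ.2.le hcard hθ
    (fun i hi j hj => (le_abs_self _).trans ((abs_sub_le_diam (θ 0) hi hj).trans h0))
    hφ₁mem.1 hφℓ
    (fun i hi j hj => by
      rw [hφ₁root, mul_div_cancel₀ _ hκ0.ne']
      exact (le_abs_self _).trans (abs_sub_le_diam ν (hAB hi) (hAB hj))) hforce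
  have hD : ∀ φ > φ₁, ∀ᶠ t in atTop, ∀ i ∈ A, ∀ j ∈ A, θ t i - θ t j ≤ φ := by
    intro φ hφ
    have hlim : Tendsto (fun t => φ₁ + (ℓ - φ₁) * Real.exp (-r * t)) atTop
        (𝓝 (φ₁ + (ℓ - φ₁) * 0)) :=
      ((Real.tendsto_exp_atBot.comp
        (tendsto_id.const_mul_atTop_of_neg (by linarith))).const_mul _).const_add _
    filter_upwards [hlim.eventually (gt_mem_nhds (by simpa using hφ)), eventually_ge_atTop 0]
      with t ht ht0 i hi j hj
    exact (hexp t ht0 i hi j hj).trans ht.le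
  have hupper : ∀ {i j}, i ∈ A → j ∈ A → ν j ≤ ν i → ∀ {c},
      Real.pi / (2 * Real.sqrt 2 * (γ * Real.cos φ₁ - (1 - γ))) * ((ν i - ν j) / κ) < c →
      ∀ᶠ t in atTop, θ t i - θ t j < c := fun hi hj hν _ hc =>
    eventually_phase_sub_lt hN hκ0 hcard hθ hφ₁mem.1 hφ2 hpos hD hi hj hν hc
  have hbound := hD (Real.pi / 2) hφ2
  have hbddA : IsBoundedUnder (· ≤ ·) atTop fun t => θ t i - θ t j :=
    isBoundedUnder_of_eventually_le (hbound.mono fun t ht => ht i hi j hj)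
  have hbddB : IsBoundedUnder (· ≥ ·) atTop fun t => θ t i - θ t j :=
    isBoundedUnder_of_eventually_ge (a := -(Real.pi / 2))
      (hbound.mono fun t ht => by linarith [ht j hj i hi])
  refine ⟨fun hν => ⟨?_, ?_⟩, fun hν => ?_⟩
  · refine le_of_forall_lt fun c hc => ?_
    obtain ⟨b, hcb, hb⟩ := exists_between hc
    obtain ⟨φ, hφφ, hφ⟩ := exists_between hφc
    refine hcb.trans_le (le_liminf_of_le hbddA.isCoboundedUnder_ge ?_)
    refine (eventually_lt_phase_sub hN hκ0 hθ hν
      (hbound.mono fun t ht => (ht j hj i hi).trans (by linarith [Real.pi_pos])) ?_ hb).mono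
      fun t => le_of_lt
    filter_upwards [hD φ hφφ] with t ht
    exact (hcosφ φ (hφ₁mem.1.trans hφφ.le) hφ).le.trans
      (mean_cos_ge_of_phase_sub_le hN hcard (by linarith [Real.pi_pos]) ht hi hj)
  · refine le_of_forall_gt fun c hc => ?_
    obtain ⟨b, hb, hbc⟩ := exists_between hc
    exact (limsup_le_of_le hbddB.isCoboundedUnder_le
      ((hupper hi hj hν.le hb).mono fun t => le_of_lt)).trans_lt hbc
  · refine tendsto_order.2 ⟨fun c hc => ?_, fun c hc => hupper hi hj hν.ge (by simpa [hν] using hc)⟩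
    filter_upwards [hupper hj hi hν.le (c := -c) (by simpa [hν] using hc)] with t ht
    linarith
end

section
/- Fix N and ν = (ν_1,…,ν_N), and suppose the coupling strength satisfies κ > 1.6·N·D(Ω). Then for Lebesgue-almost every initial phase vector Θ⁰ ∈ ℝ^N, the Kuramoto solution θ with θ(0) = Θ⁰ exhibits complete phase-locking: for every pair of indices i, j, the limit lim_{t→∞}(θ_i(t) − θ_j(t)) exists and is finite. -/
/-- Diameter of natural frequencies `D(Ω) = max_{i,j} |νᵢ − νⱼ|`. -/
noncomputable def freqDiam {N : ℕ} (ν : Fin N → ℝ) : ℝ :=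
  sSup {d : ℝ | ∃ i : Fin N, ∃ j : Fin N, d = |ν i - ν j|}

section Kuramoto

open Filter Topology Set

/-- A finite family of differentiable functions which starts below the level `c`, and each member
of which is strictly decreasing whenever it touches `c`, stays below `c`. -/
theorem forall_le_of_deriv_neg_at_level {ι : Type*} [Finite ι] {f f' : ι → ℝ → ℝ} {c : ℝ}
    (hf : ∀ p t, 0 ≤ t → HasDerivAt (f p) (f' p t) t) (h0 : ∀ p, f p 0 ≤ c)
    (hb : ∀ t, 0 ≤ t → (∀ p, f p t ≤ c) → ∀ p, f p t = c → f' p t < 0) :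
    ∀ t, 0 ≤ t → ∀ p, f p t ≤ c := by
  intro T hT
  have hsub : Icc 0 T ⊆ {t | ∀ p, f p t ≤ c} := by
    apply IsClosed.Icc_subset_of_forall_mem_nhdsWithin
    · have : {t | ∀ p, f p t ≤ c} ∩ Icc 0 T = Icc 0 T ∩ ⋂ p, (Icc 0 T ∩ f p ⁻¹' Iic c) := by
        ext t
        simp only [mem_inter_iff, mem_ofPred_eq, mem_iInter, mem_preimage, mem_Iic]
        exact ⟨fun h => ⟨h.2, fun p => ⟨h.2, h.1 p⟩⟩, fun h => ⟨fun p => (h.2 p).2, h.1⟩⟩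
      rw [this]
      refine isClosed_Icc.inter (isClosed_iInter fun p => ?_)
      refine ContinuousOn.preimage_isClosed_of_isClosed (fun t ht => ?_) isClosed_Icc isClosed_Iic
      exact (hf p t ht.1).continuousAt.continuousWithinAt
    · exact h0
    · rintro t ⟨ht, ht0, -⟩
      refine (eventually_all (l := 𝓝[>] t)).2 fun p => ?_
      rcases (ht p).lt_or_eq with h | h
      · have := (hf p t ht0).continuousAt.eventually (gt_mem_nhds h)
        exact (this.filter_mono nhdsWithin_le_nhds).mono fun _ => le_of_lt
      · have h1 := (hasDerivAt_iff_tendsto_slope.1 (hf p t ht0)).eventually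
          (gt_mem_nhds (hb t ht0 ht p h))
        have h2 : 𝓝[>] t ≤ 𝓝[≠] t := nhdsWithin_mono _ fun x hx => ne_of_gt hx
        filter_upwards [h1.filter_mono h2, self_mem_nhdsWithin] with x hx hxt
        rw [slope_def_field, div_neg_iff] at hx
        have : t < x := hxt
        rcases hx with hx | hx
        · linarith
        · linarith
  exact fun p => hsub ⟨hT, le_rfl⟩ p

/-- Barbalat's lemma: if `W` is bounded above with nonnegative Lipschitz derivative, then the
derivative tends to zero. -/
theorem tendsto_deriv_zero_of_bddAbove {W P : ℝ → ℝ} {B M : ℝ}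
    (hW : ∀ t, 0 ≤ t → HasDerivAt W (P t) t) (hP : ∀ t, 0 ≤ t → 0 ≤ P t)
    (hB : ∀ t, 0 ≤ t → W t ≤ B)
    (hM : ∀ s t, 0 ≤ s → s ≤ t → |P t - P s| ≤ M * (t - s)) :
    Tendsto P atTop (𝓝 0) := by
  have hM0 : 0 ≤ M := by
    have := (abs_nonneg _).trans (hM 0 1 le_rfl zero_le_one)
    linarith
  have hmono : MonotoneOn W (Ici 0) := by
    apply monotoneOn_of_deriv_nonneg (convex_Ici 0)
    · exact fun t ht => (hW t ht).continuousAt.continuousWithinAt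
    · intro t ht
      rw [interior_Ici] at ht
      exact (hW t ht.le).differentiableAt.differentiableWithinAt
    · intro t ht
      rw [interior_Ici] at ht
      rw [(hW t ht.le).deriv]
      exact hP t ht.le
  obtain ⟨L, hL⟩ : ∃ L, Tendsto W atTop (𝓝 L) := by
    have hm : Monotone fun t => W (max t 0) := fun a b hab =>
      hmono (mem_Ici.2 (le_max_right _ _)) (mem_Ici.2 (le_max_right _ _)) (max_le_max_right 0 hab)
    rcases tendsto_atTop_of_monotone hm with h | ⟨L, h⟩
    · exfalso
      obtain ⟨t, ht⟩ := (h.eventually (eventually_gt_atTop B)).exists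
      exact absurd (hB (max t 0) (le_max_right _ _)) (not_le.2 ht)
    · refine ⟨L, h.congr' ?_⟩
      filter_upwards [eventually_ge_atTop 0] with t ht
      rw [max_eq_left ht]
  have key : ∀ t τ, 0 ≤ t → 0 < τ → P t * τ ≤ W (t + τ) - W t + M * τ * τ := by
    intro t τ ht hτ
    obtain ⟨ξ, hξ, h⟩ := exists_hasDerivAt_eq_slope W P (lt_add_of_pos_right t hτ)
      (fun s hs => (hW s (ht.trans hs.1)).continuousAt.continuousWithinAt)
      (fun s hs => hW s (ht.trans hs.1.le))
    have h1 := (abs_le.1 (hM t ξ ht hξ.1.le)).1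
    have h2 : P ξ * τ = W (t + τ) - W t := by
      rw [h, add_sub_cancel_left, div_mul_cancel₀ _ hτ.ne']
    have h3 : M * (ξ - t) ≤ M * τ := mul_le_mul_of_nonneg_left (by linarith [hξ.2]) hM0
    have h4 : (P t - M * τ) * τ ≤ P ξ * τ := mul_le_mul_of_nonneg_right (by linarith) hτ.le
    linarith
  rw [Metric.tendsto_atTop]
  intro ε hε
  set τ := ε / (2 * (M + 1)) with hτ
  have hτ0 : 0 < τ := by positivity
  have hMτ : M * τ ≤ ε / 2 := by
    rw [hτ, mul_div_assoc', div_le_div_iff₀ (by positivity) (by norm_num)]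
    nlinarith
  have hd : Tendsto (fun t => W (t + τ) - W t) atTop (𝓝 0) := by
    simpa using (hL.comp (tendsto_atTop_add_const_right atTop τ tendsto_id)).sub hL
  have he := hd.eventually (gt_mem_nhds (show 0 < ε / 2 * τ by positivity))
  obtain ⟨T, hT⟩ := eventually_atTop.1 (he.and (eventually_ge_atTop 0))
  refine ⟨T, fun t ht => ?_⟩
  obtain ⟨h1, h0⟩ := hT t ht
  rw [Real.dist_eq, sub_zero, abs_of_nonneg (hP t h0)]
  have h2 := key t τ h0 hτ0
  have h3 : M * τ * τ ≤ ε / 2 * τ := mul_le_mul_of_nonneg_right hMτ hτ0.le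
  exact lt_of_mul_lt_mul_right (by linarith) hτ0.le

/-- A bounded continuous function converges if the set of values it takes at arbitrarily large
times contains no open interval. -/
theorem exists_tendsto_of_frequently_eq {f : ℝ → ℝ} {B : ℝ}
    (hf : ∀ t, 0 ≤ t → ContinuousAt f t) (hB : ∀ t, 0 ≤ t → |f t| ≤ B)
    (hZ : ∀ a b, a < b → ∃ v ∈ Ioo a b, ¬ ∃ᶠ t in atTop, f t = v) :
    ∃ L, Tendsto f atTop (𝓝 L) := by
  refine tendsto_of_no_upcrossings dense_univ ?_ ?_ ?_
  · rintro a - b - hab ⟨ha, hb⟩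
    obtain ⟨v, hv, hn⟩ := hZ a b hab
    refine hn (frequently_atTop.2 fun T => ?_)
    obtain ⟨s, hs, hsa⟩ := frequently_atTop.1 ha (max T 0)
    obtain ⟨r, hr, hrb⟩ := frequently_atTop.1 hb (max T 0)
    have hcont : ContinuousOn f (uIcc s r) := fun x hx =>
      (hf x ((le_max_right T 0).trans ((le_inf hs hr).trans hx.1))).continuousWithinAt
    obtain ⟨x, hx, hxv⟩ := intermediate_value_uIcc hcont
      (show v ∈ uIcc (f s) (f r) from
        ⟨inf_le_left.trans (hsa.trans hv.1).le, (hv.2.trans hrb).le.trans le_sup_right⟩)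
    exact ⟨x, (le_max_left T 0).trans ((le_inf hs hr).trans hx.1), hxv⟩
  · exact ⟨B, eventually_map.2 ((eventually_ge_atTop 0).mono fun t ht => (abs_le.1 (hB t ht)).2)⟩
  · exact ⟨-B, eventually_map.2 ((eventually_ge_atTop 0).mono fun t ht => (abs_le.1 (hB t ht)).1)⟩

/-- If the square of a continuous function converges, then so does the function. -/
theorem exists_tendsto_of_tendsto_sq {f : ℝ → ℝ} {B L : ℝ}
    (hf : ∀ t, 0 ≤ t → ContinuousAt f t) (hB : ∀ t, 0 ≤ t → |f t| ≤ B)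
    (h : Tendsto (fun t => f t ^ 2) atTop (𝓝 L)) : ∃ l, Tendsto f atTop (𝓝 l) := by
  refine exists_tendsto_of_frequently_eq hf hB fun a b hab => ?_
  by_contra! hcon
  have hsq : ∀ v ∈ Ioo a b, v ^ 2 = L := by
    intro v hv
    by_contra hne
    refine hcon v hv ((h.eventually_ne (Ne.symm hne)).mono fun t ht hft => ht (by rw [hft]))
  have h1 := hsq ((3 * a + b) / 4) ⟨by linarith, by linarith⟩
  have h2 := hsq ((2 * a + 2 * b) / 4) ⟨by linarith, by linarith⟩
  have h3 := hsq ((a + 3 * b) / 4) ⟨by linarith, by linarith⟩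
  nlinarith [sq_pos_of_pos (sub_pos.2 hab)]

theorem exists_tendsto_of_tendsto_cos {f : ℝ → ℝ} {B L : ℝ}
    (hf : ∀ t, 0 ≤ t → ContinuousAt f t) (hB : ∀ t, 0 ≤ t → |f t| ≤ B)
    (h : Tendsto (fun t => Real.cos (f t)) atTop (𝓝 L)) : ∃ l, Tendsto f atTop (𝓝 l) := by
  refine exists_tendsto_of_frequently_eq hf hB fun a b hab => ?_
  by_contra! hcon
  have hcos : ∀ v ∈ Ioo a b, Real.cos v = L := by
    intro v hv
    by_contra hne
    refine hcon v hv ((h.eventually_ne (Ne.symm hne)).mono fun t ht hft => ht (by rw [hft]))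
  have hsin : ∀ v ∈ Ioo a b, Real.sin v = 0 := by
    intro v hv
    have h1 : HasDerivAt Real.cos 0 v :=
      (hasDerivAt_const v L).congr_of_eventuallyEq
        (eventually_of_mem (Ioo_mem_nhds hv.1 hv.2) hcos)
    simpa using (Real.hasDerivAt_cos v).unique h1
  have hm : (a + b) / 2 ∈ Ioo a b := ⟨by linarith, by linarith⟩
  have h1 : HasDerivAt Real.sin 0 ((a + b) / 2) :=
    (hasDerivAt_const _ (0 : ℝ)).congr_of_eventuallyEq
      (eventually_of_mem (Ioo_mem_nhds hm.1 hm.2) hsin)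
  have h2 := (Real.hasDerivAt_sin _).unique h1
  have h3 := Real.sin_sq_add_cos_sq ((a + b) / 2)
  rw [h2, hsin _ hm] at h3
  norm_num at h3

/-- For fixed signs `ε`, the equation `v = (∑ i, ε i * √(v - A i)) / N` has only finitely many
solutions on compact intervals in `{v | ∀ i, A i < v}`; hence finitely
many sign patterns cannot account for every `v` in an open interval. -/
theorem exists_forall_sign_ne {N : ℕ} (hN : 1 ≤ N) (A : Fin N → ℝ) {a b : ℝ} (hab : a < b)
    (hA : ∀ i, A i ≤ a) :
    ∃ v ∈ Ioo a b, ∀ ε : Fin N → Bool,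
      v ≠ (∑ i, (if ε i then 1 else -1) * √(v - A i)) / N := by
  by_contra! hcon
  set G : (Fin N → Bool) → ℝ → ℝ := fun ε v =>
    (∑ i, (if ε i then 1 else -1) * √(v - A i)) / N with hG
  have hNpos : (0 : ℝ) < N := by exact_mod_cast hN
  obtain ⟨a', ha', hab'⟩ := exists_between hab
  obtain ⟨b', hmid, hb'⟩ := exists_between hab'
  have hcover : Icc a' b' ⊆ ⋃ ε, {v ∈ Icc a' b' | v = G ε v} := by
    intro v hv
    obtain ⟨ε, hε⟩ := hcon v ⟨ha'.trans_le hv.1, hv.2.trans_lt hb'⟩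
    exact mem_iUnion.2 ⟨ε, hv, hε⟩
  obtain ⟨ε, hε⟩ : ∃ ε, {v ∈ Icc a' b' | v = G ε v}.Infinite := by
    by_contra! hfin
    exact Icc_infinite hmid ((finite_iUnion hfin).subset hcover)
  obtain ⟨z, hz, hacc⟩ := hε.exists_accPt_of_subset_isCompact isCompact_Icc (sep_subset _ _)
  have hanG : AnalyticOnNhd ℝ (G ε) (Ioi a) := by
    intro v hv
    refine AnalyticAt.div ?_ analyticAt_const hNpos.ne'
    refine Finset.analyticAt_fun_sum _ fun i _ => analyticAt_const.mul ?_
    have h1 : AnalyticAt ℝ Real.sqrt (v - A i) :=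
      (Real.contDiffAt_sqrt (sub_pos.2 ((hA i).trans_lt hv)).ne').analyticAt
    exact h1.comp (f := fun v => v - A i) (analyticAt_id.sub analyticAt_const)
  have hfreq : ∃ᶠ v in 𝓝[≠] z, id v = G ε v := by
    have := accPt_iff_frequently_nhdsNE.1 hacc
    exact this.mono fun v hv => hv.2
  have heq := analyticOnNhd_id.eqOn_of_preconnected_of_frequently_eq hanG isPreconnected_Ioi
    (show z ∈ Ioi a from ha'.trans_le hz.1) hfreq
  set w := |a| + 4 + ∑ i, |A i| with hw
  have hsum : 0 ≤ ∑ i, |A i| := Finset.sum_nonneg fun i _ => abs_nonneg _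
  have hwa : a < w := by linarith [le_abs_self a]
  have hw4 : 4 ≤ w := by linarith [abs_nonneg a]
  have hww : w * N = ∑ i, (if ε i then 1 else -1) * √(w - A i) := by
    have : w = G ε w := heq hwa
    rw [hG] at this
    field_simp at this
    linarith
  have hle : ∑ i, (if ε i then 1 else -1) * √(w - A i) ≤ ∑ _i : Fin N, √(2 * w) := by
    refine Finset.sum_le_sum fun i _ => ?_
    have h1 : √(w - A i) ≤ √(2 * w) := by
      apply Real.sqrt_le_sqrt
      have : |A i| ≤ ∑ i, |A i| :=
        Finset.single_le_sum (f := fun i => |A i|) (fun i _ => abs_nonneg _) (Finset.mem_univ i)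
      have h3 := neg_abs_le (A i)
      linarith [abs_nonneg a]
    have h2 := Real.sqrt_nonneg (w - A i)
    split_ifs <;> linarith
  rw [Finset.sum_const, Finset.card_univ, Fintype.card_fin, nsmul_eq_mul, ← hww] at hle
  have h4 : w ≤ √(2 * w) := by nlinarith
  have h5 := Real.sq_sqrt (show 0 ≤ 2 * w by linarith)
  nlinarith

/-- The mean `(∑ j, sin (x j - x i)) / N`. -/
noncomputable def meanSin {N : ℕ} (x : Fin N → ℝ) (i : Fin N) : ℝ :=
  (∑ j, Real.sin (x j - x i)) / N

/-- The mean `(∑ j, cos (x j - x i)) / N`. -/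
noncomputable def meanCos {N : ℕ} (x : Fin N → ℝ) (i : Fin N) : ℝ :=
  (∑ j, Real.cos (x j - x i)) / N

/-- The square of the modulus of the Kuramoto order parameter. -/
noncomputable def orderSq {N : ℕ} (x : Fin N → ℝ) : ℝ :=
  ((∑ j, Real.cos (x j)) / N) ^ 2 + ((∑ j, Real.sin (x j)) / N) ^ 2

/-- A Kuramoto solution which is differentiable in the two-sided sense on `[0, ∞)`. -/
def IsKuramotoFlow {N : ℕ} (κ : ℝ) (ν : Fin N → ℝ) (θ : ℝ → Fin N → ℝ) : Prop :=
  ∀ t, 0 ≤ t → ∀ i, HasDerivAt (fun s => θ s i) (ν i + κ * meanSin (θ t) i) t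

section OrderParameter

variable {N : ℕ} (x : Fin N → ℝ)

theorem mean_cos_sub (m : ℝ) :
    (∑ j, Real.cos (x j - m)) / N =
      (∑ j, Real.cos (x j)) / N * Real.cos m + (∑ j, Real.sin (x j)) / N * Real.sin m := by
  simp only [Real.cos_sub, Finset.sum_add_distrib, ← Finset.sum_mul]
  ring

theorem mean_sin_sub (m : ℝ) :
    (∑ j, Real.sin (x j - m)) / N =
      (∑ j, Real.sin (x j)) / N * Real.cos m - (∑ j, Real.cos (x j)) / N * Real.sin m := by
  simp only [Real.sin_sub, Finset.sum_sub_distrib, ← Finset.sum_mul]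
  ring

theorem mean_sin_sq_add_mean_cos_sq (m : ℝ) :
    ((∑ j, Real.sin (x j - m)) / N) ^ 2 + ((∑ j, Real.cos (x j - m)) / N) ^ 2 = orderSq x := by
  rw [mean_sin_sub, mean_cos_sub, orderSq]
  linear_combination (((∑ j, Real.cos (x j)) / N) ^ 2 + ((∑ j, Real.sin (x j)) / N) ^ 2) *
    Real.sin_sq_add_cos_sq m

theorem meanSin_sq_add_meanCos_sq (i : Fin N) :
    meanSin x i ^ 2 + meanCos x i ^ 2 = orderSq x :=
  mean_sin_sq_add_mean_cos_sq x (x i)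

theorem sum_meanSin : ∑ i, meanSin x i = 0 := by
  simp only [meanSin, mean_sin_sub, Finset.sum_sub_distrib, ← Finset.mul_sum]
  ring

theorem mean_meanCos : (∑ i, meanCos x i) / N = orderSq x := by
  simp only [meanCos, mean_cos_sub, Finset.sum_add_distrib, ← Finset.mul_sum, orderSq]
  ring

theorem orderSq_nonneg : 0 ≤ orderSq x := by
  unfold orderSq
  positivity

theorem abs_sum_div_le {f : Fin N → ℝ} {M : ℝ} (hM : 0 ≤ M) (hf : ∀ i, |f i| ≤ M) :
    |(∑ i, f i) / N| ≤ M := by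
  have h1 : |∑ i, f i| ≤ N * M := by
    refine (Finset.abs_sum_le_sum_abs _ _).trans ((Finset.sum_le_sum fun i _ => hf i).trans ?_)
    simp
  rcases N.eq_zero_or_pos with rfl | hN
  · simpa using hM
  · have : (0 : ℝ) < N := by exact_mod_cast hN
    rw [abs_div, abs_of_pos this, div_le_iff₀ this]
    linarith

theorem abs_meanSin_le (i : Fin N) : |meanSin x i| ≤ 1 :=
  abs_sum_div_le zero_le_one fun _ => Real.abs_sin_le_one _

theorem abs_meanCos_le (i : Fin N) : |meanCos x i| ≤ 1 :=
  abs_sum_div_le zero_le_one fun _ => Real.abs_cos_le_one _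

theorem orderSq_le_one : orderSq x ≤ 1 := by
  rw [← mean_meanCos]
  exact (le_abs_self _).trans (abs_sum_div_le zero_le_one (abs_meanCos_le x))

theorem cos_sub_mul_orderSq (i j : Fin N) :
    Real.cos (x i - x j) * orderSq x = meanCos x i * meanCos x j + meanSin x i * meanSin x j := by
  simp only [meanCos, meanSin, mean_cos_sub, mean_sin_sub, orderSq]
  rw [Real.cos_sub]
  ring

theorem meanSin_sub_meanSin (i j : Fin N) :
    meanSin x i - meanSin x j =
      -(2 * Real.sin ((x i - x j) / 2) * ((∑ k, Real.cos (x k - (x i + x j) / 2)) / N)) := by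
  simp only [meanSin]
  rw [← sub_div, ← Finset.sum_sub_distrib, ← mul_div_assoc, Finset.mul_sum, ← neg_div,
    ← Finset.sum_neg_distrib]
  congr 1
  refine Finset.sum_congr rfl fun k _ => ?_
  rw [Real.sin_sub_sin]
  have h1 : (x k - x i - (x k - x j)) / 2 = -((x i - x j) / 2) := by ring
  have h2 : (x k - x i + (x k - x j)) / 2 = x k - (x i + x j) / 2 := by ring
  rw [h1, h2, Real.sin_neg]
  ring

theorem meanSin_sub_int (n : Fin N → ℤ) (i : Fin N) :
    meanSin (fun j => x j - n j * (2 * Real.pi)) i = meanSin x i := by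
  simp only [meanSin]
  congr 1
  refine Finset.sum_congr rfl fun k _ => ?_
  rw [← Real.sin_sub_int_mul_two_pi (x k - x i) (n k - n i)]
  congr 1
  push_cast
  ring

/-- A lower bound for the mean of `cos (x k - m)` when the members of `A` lie within `β` of `m`. -/
theorem le_mean_cos_of_cluster (hN : 1 ≤ N) {A : Finset (Fin N)} {β m : ℝ} (hβ : β ≤ Real.pi)
    (hA : ∀ k ∈ A, |x k - m| ≤ β) :
    (A.card : ℝ) / N * (1 + Real.cos β) - 1 ≤ (∑ k, Real.cos (x k - m)) / N := by
  have hNpos : (0 : ℝ) < N := by exact_mod_cast hN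
  have h : ∑ k : Fin N, ((if k ∈ A then 1 + Real.cos β else 0) - 1) ≤
      ∑ k, Real.cos (x k - m) := by
    refine Finset.sum_le_sum fun k _ => ?_
    split_ifs with hk
    · rw [← Real.cos_abs (x k - m)]
      have := Real.cos_le_cos_of_nonneg_of_le_pi (abs_nonneg _) hβ (hA k hk)
      linarith
    · linarith [Real.neg_one_le_cos (x k - m)]
  rw [Finset.sum_sub_distrib, Finset.sum_ite_mem, Finset.univ_inter] at h
  simp only [Finset.sum_const, nsmul_eq_mul, Finset.card_univ, Fintype.card_fin, mul_one] at h
  rw [le_div_iff₀ hNpos]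
  have h2 : ((A.card : ℝ) / N * (1 + Real.cos β) - 1) * N = A.card * (1 + Real.cos β) - N := by
    field_simp
  linarith

/-- If the members of `A` lie in an arc of half-width `β`, the order parameter is bounded below. -/
theorem sq_le_orderSq_of_cluster (hN : 1 ≤ N) {A : Finset (Fin N)} {β : ℝ} (hβ : β ≤ Real.pi)
    (hρ : 0 ≤ (A.card : ℝ) / N * (1 + Real.cos β) - 1)
    (hA : ∀ i ∈ A, ∀ j ∈ A, x i - x j ≤ 2 * β) :
    ((A.card : ℝ) / N * (1 + Real.cos β) - 1) ^ 2 ≤ orderSq x := by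
  have hne : A.Nonempty := by
    by_contra h
    rw [Finset.not_nonempty_iff_eq_empty] at h
    norm_num [h] at hρ
  obtain ⟨i, hi, hmax⟩ := A.exists_max_image x hne
  obtain ⟨j, hj, hmin⟩ := A.exists_min_image x hne
  have h := le_mean_cos_of_cluster x hN (m := (x i + x j) / 2) hβ fun k hk => by
    rw [abs_le]
    constructor <;> linarith [hmax k hk, hmin k hk, hA i hi j hj]
  rw [← mean_sin_sq_add_mean_cos_sq x ((x i + x j) / 2)]
  nlinarith [sq_nonneg ((∑ k, Real.sin (x k - (x i + x j) / 2)) / N)]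

end OrderParameter

namespace IsKuramotoFlow

variable {N : ℕ} {κ : ℝ} {ν : Fin N → ℝ} {θ : ℝ → Fin N → ℝ}

theorem comp_add_sub (h : IsKuramotoFlow κ ν θ) {s : ℝ} (hs : 0 ≤ s) (n : Fin N → ℤ) :
    IsKuramotoFlow κ ν fun t i => θ (t + s) i - n i * (2 * Real.pi) := by
  intro t ht i
  have h1 := (h (t + s) (by positivity) i).comp_add_const t s
  rw [← meanSin_sub_int (θ (t + s)) n i] at h1
  exact h1.sub_const _

theorem continuousAt (h : IsKuramotoFlow κ ν θ) {t : ℝ} (ht : 0 ≤ t) (i : Fin N) :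
    ContinuousAt (fun s => θ s i) t :=
  (h t ht i).continuousAt

theorem hasDerivAt_orderSq (h : IsKuramotoFlow κ ν θ) {t : ℝ} (ht : 0 ≤ t) :
    HasDerivAt (fun s => orderSq (θ s))
      (2 * ((∑ i, meanSin (θ t) i * (ν i + κ * meanSin (θ t) i)) / N)) t := by
  have hc : HasDerivAt (fun s => (∑ j, Real.cos (θ s j)) / N)
      ((∑ j, -Real.sin (θ t j) * (ν j + κ * meanSin (θ t) j)) / N) t :=
    (HasDerivAt.fun_sum fun j _ => (h t ht j).cos).div_const _
  have hs : HasDerivAt (fun s => (∑ j, Real.sin (θ s j)) / N)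
      ((∑ j, Real.cos (θ t j) * (ν j + κ * meanSin (θ t) j)) / N) t :=
    (HasDerivAt.fun_sum fun j _ => (h t ht j).sin).div_const _
  refine ((hc.pow 2).add (hs.pow 2)).congr_deriv ?_
  have key : ∀ i, meanSin (θ t) i = (∑ j, Real.sin (θ t j)) / N * Real.cos (θ t i) -
    (∑ j, Real.cos (θ t j)) / N * Real.sin (θ t i) := fun i => mean_sin_sub (θ t) (θ t i)
  simp only [key, sub_mul, Finset.sum_sub_distrib, mul_assoc, ← Finset.mul_sum, neg_mul,
    Finset.sum_neg_distrib]
  ring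

theorem hasDerivAt_meanSin (h : IsKuramotoFlow κ ν θ) {t : ℝ} (ht : 0 ≤ t) (i : Fin N) :
    HasDerivAt (fun s => meanSin (θ s) i)
      ((∑ j, Real.cos (θ t j - θ t i) *
        ((ν j + κ * meanSin (θ t) j) - (ν i + κ * meanSin (θ t) i))) / N) t :=
  (HasDerivAt.fun_sum fun j _ => ((h t ht j).sub (h t ht i)).sin).div_const _

theorem continuousAt_orderSq (h : IsKuramotoFlow κ ν θ) {t : ℝ} (ht : 0 ≤ t) :
    ContinuousAt (fun s => orderSq (θ s)) t :=
  (h.hasDerivAt_orderSq ht).continuousAt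

theorem continuousAt_meanCos (h : IsKuramotoFlow κ ν θ) {t : ℝ} (ht : 0 ≤ t) (i : Fin N) :
    ContinuousAt (fun s => meanCos (θ s) i) t := by
  have : HasDerivAt (fun s => meanCos (θ s) i) _ t :=
    (HasDerivAt.fun_sum fun j _ => ((h t ht j).sub (h t ht i)).cos).div_const _
  exact this.continuousAt

/-- A majority cluster contained in an arc of length `2 * β` stays in such an arc. -/
theorem cluster_invariant (h : IsKuramotoFlow κ ν θ) (hN : 1 ≤ N) (hκ : 0 < κ) {D β : ℝ}
    (hβ0 : 0 ≤ β) (hβ : β ≤ Real.pi) {A : Finset (Fin N)} (hν : ∀ i j, ν i - ν j ≤ D)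
    (hD : D < κ * (2 * Real.sin β * ((A.card : ℝ) / N * (1 + Real.cos β) - 1)))
    (h0 : ∀ i ∈ A, ∀ j ∈ A, θ 0 i - θ 0 j ≤ 2 * β) {t : ℝ} (ht : 0 ≤ t) :
    ∀ i ∈ A, ∀ j ∈ A, θ t i - θ t j ≤ 2 * β := by
  have := forall_le_of_deriv_neg_at_level (ι := A × A) (c := 2 * β)
    (f := fun p s => θ s p.1 - θ s p.2)
    (f' := fun p s => (ν p.1 + κ * meanSin (θ s) p.1) - (ν p.2 + κ * meanSin (θ s) p.2))
    (fun p s hs => (h s hs p.1).sub (h s hs p.2)) (fun p => h0 _ p.1.2 _ p.2.2) ?_ t ht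
  · exact fun i hi j hj => this (⟨i, hi⟩, ⟨j, hj⟩)
  · rintro s hs hle ⟨⟨i, hi⟩, ⟨j, hj⟩⟩ heq
    have hle' : ∀ k ∈ A, ∀ l ∈ A, θ s k - θ s l ≤ 2 * β := fun k hk l hl =>
      hle (⟨k, hk⟩, ⟨l, hl⟩)
    simp only at heq ⊢
    have h1 := le_mean_cos_of_cluster (θ s) hN (m := (θ s i + θ s j) / 2) hβ fun k hk => by
      rw [abs_le]
      constructor <;> linarith [hle' i hi k hk, hle' k hk j hj]
    have h2 := meanSin_sub_meanSin (θ s) i j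
    rw [heq, mul_div_cancel_left₀ β two_ne_zero] at h2
    have h3 := mul_le_mul_of_nonneg_left h1
      (mul_nonneg zero_le_two (Real.sin_nonneg_of_nonneg_of_le_pi hβ0 hβ))
    have h4 : κ * (meanSin (θ s) i - meanSin (θ s) j) ≤
        κ * -(2 * Real.sin β * ((A.card : ℝ) / N * (1 + Real.cos β) - 1)) :=
      mul_le_mul_of_nonneg_left (by linarith) hκ.le
    linarith [hν i j]

/-- If a majority cluster is trapped in an arc, then all phase differences are bounded: any other
oscillator that meets the cluster is captured by it. -/
theorem exists_bound_of_cluster (h : IsKuramotoFlow κ ν θ) (hN : 1 ≤ N) (hκ : 0 < κ) {D β : ℝ}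
    (hβ0 : 0 ≤ β) (hβ : β ≤ Real.pi) {A : Finset (Fin N)} (hne : A.Nonempty)
    (hν : ∀ i j, ν i - ν j ≤ D)
    (hD : D < κ * (2 * Real.sin β * ((A.card : ℝ) / N * (1 + Real.cos β) - 1)))
    (h0 : ∀ i ∈ A, ∀ j ∈ A, θ 0 i - θ 0 j ≤ 2 * β) :
    ∃ B, ∀ t, 0 ≤ t → ∀ i j, |θ t i - θ t j| ≤ B := by
  obtain ⟨p, hp⟩ := hne
  have key : ∀ k, ∃ B, ∀ t, 0 ≤ t → |θ t k - θ t p| ≤ B := by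
    intro k
    by_cases hmeet : ∃ s, 0 ≤ s ∧ ∃ n : ℤ, θ s k - θ s p = n * (2 * Real.pi)
    · obtain ⟨s, hs, n, hn⟩ := hmeet
      have hcont : ContinuousOn (fun t => θ t k - θ t p) (Icc 0 s) := fun t ht =>
        ((h.continuousAt ht.1 k).sub (h.continuousAt ht.1 p)).continuousWithinAt
      obtain ⟨B, hB⟩ := isCompact_Icc.exists_bound_of_continuousOn hcont
      refine ⟨max B (2 * β + |n * (2 * Real.pi)|), fun t ht => ?_⟩
      rcases le_total t s with hts | hts
      · exact (hB t ⟨ht, hts⟩).trans (le_max_left _ _)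
      refine le_trans ?_ (le_max_right _ _)
      have hA := fun t ht => h.cluster_invariant hN hκ hβ0 hβ hν hD h0 (t := t) ht
      by_cases hk : k ∈ A
      · have h1 := hA t ht k hk p hp
        have h2 := hA t ht p hp k hk
        have h3 := abs_nonneg ((n : ℝ) * (2 * Real.pi))
        rw [abs_le]
        constructor <;> linarith
      set e : Fin N → ℤ := fun i => if i = k then n else 0 with he
      have hek : e k = n := by simp [he]
      have heA : ∀ i ∈ A, e i = 0 := fun i hi => by
        simp [he, show i ≠ k from fun hik => hk (hik ▸ hi)]
      have hflow := h.comp_add_sub hs e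
      have hcard : (A.card : ℝ) ≤ ((insert k A).card : ℝ) := by
        exact_mod_cast Finset.card_le_card (Finset.subset_insert k A)
      have hD' : D < κ * (2 * Real.sin β *
          (((insert k A).card : ℝ) / N * (1 + Real.cos β) - 1)) := by
        refine hD.trans_le (mul_le_mul_of_nonneg_left (mul_le_mul_of_nonneg_left ?_ ?_) hκ.le)
        · have := Real.neg_one_le_cos β
          have h5 : 0 ≤ 1 + Real.cos β := by linarith
          gcongr
        · exact mul_nonneg zero_le_two (Real.sin_nonneg_of_nonneg_of_le_pi hβ0 hβ)
      have hinv := hflow.cluster_invariant hN hκ hβ0 hβ (A := insert k A) hν hD' (by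
        intro i hi j hj
        simp only [zero_add]
        rcases Finset.mem_insert.1 hi with rfl | hiA <;>
          rcases Finset.mem_insert.1 hj with rfl | hjA
        · linarith
        · rw [hek, heA j hjA]
          have := hA s hs p hp j hjA
          push_cast
          linarith
        · rw [hek, heA i hiA]
          have := hA s hs i hiA p hp
          push_cast
          linarith
        · rw [heA i hiA, heA j hjA]
          have := hA s hs i hiA j hjA
          linarith) (sub_nonneg.2 hts)
      have hkm := Finset.mem_insert_self k A
      have hpm := Finset.mem_insert_of_mem hp (b := k)
      have h1 := hinv k hkm p hpm
      have h2 := hinv p hpm k hkm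
      simp only [sub_add_cancel, hek, heA p hp] at h1 h2
      have h3 := abs_le.1 (le_refl |n * (2 * Real.pi)|)
      push_cast at h1 h2
      rw [abs_le]
      constructor <;> linarith
    · push Not at hmeet
      set n := ⌊(θ 0 k - θ 0 p) / (2 * Real.pi)⌋ with hn
      have hpi := Real.two_pi_pos
      have hlo : (n : ℝ) * (2 * Real.pi) ≤ θ 0 k - θ 0 p := by
        rw [← le_div_iff₀ hpi]
        exact Int.floor_le _
      have hhi : θ 0 k - θ 0 p ≤ ((n + 1 : ℤ) : ℝ) * (2 * Real.pi) := by
        rw [← div_le_iff₀ hpi]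
        push_cast
        exact (Int.lt_floor_add_one _).le
      refine ⟨|n * (2 * Real.pi)| + 2 * Real.pi, fun t ht => ?_⟩
      have hcont : ContinuousOn (fun t => θ t k - θ t p) (Icc 0 t) := fun s hs =>
        ((h.continuousAt hs.1 k).sub (h.continuousAt hs.1 p)).continuousWithinAt
      have h1 : (n : ℝ) * (2 * Real.pi) ≤ θ t k - θ t p := by
        by_contra! hlt
        obtain ⟨s, hs, hs'⟩ := intermediate_value_Icc' ht hcont ⟨hlt.le, hlo⟩
        exact hmeet s hs.1 n hs'
      have h2 : θ t k - θ t p ≤ ((n + 1 : ℤ) : ℝ) * (2 * Real.pi) := by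
        by_contra! hlt
        obtain ⟨s, hs, hs'⟩ := intermediate_value_Icc ht hcont ⟨hhi, hlt.le⟩
        exact hmeet s hs.1 (n + 1) hs'
      push_cast at h2
      have h3 := abs_le.1 (le_refl |n * (2 * Real.pi)|)
      rw [abs_le]
      constructor <;> linarith
  choose B hB using key
  refine ⟨2 * ∑ k, |B k|, fun t ht i j => ?_⟩
  have hs : ∀ k, |θ t k - θ t p| ≤ ∑ k, |B k| := fun k =>
    (hB k t ht).trans ((le_abs_self _).trans
      (Finset.single_le_sum (f := fun k => |B k|) (fun _ _ => abs_nonneg _) (Finset.mem_univ k)))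
  have h1 := abs_le.1 (hs i)
  have h2 := abs_le.1 (hs j)
  rw [abs_le]
  constructor <;> linarith

end IsKuramotoFlow

/-- In a configuration whose order parameter dominates the mean of the squares of the `meanSin`,
a majority of the oscillators lies, modulo `2 * π`, in a short arc. -/
theorem exists_cluster {N : ℕ} (hN : 1 ≤ N) (x : Fin N → ℝ) (hu : 0 < orderSq x)
    (hw : (∑ i, meanSin x i ^ 2) / N ≤ (orderSq x / (16 / 5)) ^ 2) :
    ∃ (n : Fin N → ℤ) (A : Finset (Fin N)) (β : ℝ), 0 ≤ β ∧ β ≤ Real.pi ∧ A.Nonempty ∧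
      0 < (A.card : ℝ) / N * (1 + Real.cos β) - 1 ∧
      orderSq x / (8 / 5) ≤ 2 * Real.sin β * ((A.card : ℝ) / N * (1 + Real.cos β) - 1) ∧
      ∀ i ∈ A, ∀ j ∈ A,
        (x i - n i * (2 * Real.pi)) - (x j - n j * (2 * Real.pi)) ≤ 2 * β := by
  have hNpos : (0 : ℝ) < N := by exact_mod_cast hN
  obtain ⟨r, φ, hr0, hru, hrC⟩ : ∃ r φ : ℝ, 0 < r ∧ r ^ 2 = orderSq x ∧
      ∀ i, meanCos x i = r * Real.cos (x i - φ) := by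
    set z : ℂ := ⟨(∑ j, Real.cos (x j)) / N, (∑ j, Real.sin (x j)) / N⟩ with hz
    have hzu : ‖z‖ ^ 2 = orderSq x := by
      rw [← Complex.normSq_eq_norm_sq, Complex.normSq_apply, orderSq, hz]
      ring
    have hc : ‖z‖ * Real.cos z.arg = (∑ j, Real.cos (x j)) / N := Complex.norm_mul_cos_arg z
    have hs : ‖z‖ * Real.sin z.arg = (∑ j, Real.sin (x j)) / N := Complex.norm_mul_sin_arg z
    refine ⟨‖z‖, z.arg, ?_, hzu, fun i => ?_⟩
    · rw [← hzu] at hu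
      exact (norm_nonneg z).lt_of_ne fun h => by simp [← h] at hu
    · rw [meanCos, mean_cos_sub, Real.cos_sub, ← hc, ← hs]
      ring
  have hr1 : r ≤ 1 := by
    have := orderSq_le_one x
    nlinarith
  set b : ℝ := 1 - 37 / 100 * r with hb
  have hb0 : 0 < b := by linarith
  have hb1 : b ≤ 1 := by linarith
  set A : Finset (Fin N) := Finset.univ.filter fun i => r * b ≤ meanCos x i with hA
  set s2 : ℝ := 1 - b ^ 2 with hs2
  have hs2' : s2 = 37 / 100 * r * (2 - 37 / 100 * r) := by rw [hs2, hb]; ring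
  have hs2pos : 0 < s2 := by
    rw [hs2']
    exact mul_pos (by linarith) (by linarith)
  have hpoint : ∀ i, meanCos x i ≤ r * ((if i ∈ A then 1 + b else 0) - b) +
      2 * b / (r * s2) * meanSin x i ^ 2 := by
    intro i
    have h1 := meanSin_sq_add_meanCos_sq x i
    rw [← hru] at h1
    have hpos : 0 ≤ 2 * b / (r * s2) * meanSin x i ^ 2 := by positivity
    by_cases hi : i ∈ A
    · have h2 : meanCos x i ≤ r := by nlinarith [sq_nonneg (meanSin x i)]
      rw [if_pos hi]
      linarith
    · rw [if_neg hi]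
      have hi' : meanCos x i < r * b := by simpa [hA] using hi
      rcases le_total (r ^ 2 * s2) (meanSin x i ^ 2) with h2 | h2
      · have h3 : 2 * b / (r * s2) * (r ^ 2 * s2) ≤ 2 * b / (r * s2) * meanSin x i ^ 2 :=
          mul_le_mul_of_nonneg_left h2 (by positivity)
        have h4 : 2 * b / (r * s2) * (r ^ 2 * s2) = 2 * b * r := by
          field_simp
        linarith
      · have h3 : 0 ≤ (r * b - meanCos x i) * (-(r * b) - meanCos x i) := by
          rw [hs2] at h2
          linarith
        have h4 := nonneg_of_mul_nonneg_right h3 (by linarith)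
        linarith
  have hsum := Finset.sum_le_sum fun i (_ : i ∈ Finset.univ) => hpoint i
  rw [Finset.sum_add_distrib, ← Finset.mul_sum, ← Finset.mul_sum, Finset.sum_sub_distrib,
    Finset.sum_ite_mem, Finset.univ_inter] at hsum
  simp only [Finset.sum_const, nsmul_eq_mul, Finset.card_univ, Fintype.card_fin] at hsum
  set ρ : ℝ := (A.card : ℝ) / N * (1 + b) - 1 with hρ
  have hmean : r ^ 2 ≤ r * (1 + ρ - b) + 2 * b / (r * s2) * (r ^ 2 / (16 / 5)) ^ 2 := by
    have h1 := div_le_div_of_nonneg_right hsum hNpos.le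
    rw [mean_meanCos, add_div, mul_div_assoc, mul_div_assoc, sub_div,
      mul_div_cancel_left₀ _ hNpos.ne'] at h1
    rw [hru]
    have h2 : 2 * b / (r * s2) * ((∑ i, meanSin x i ^ 2) / N) ≤
        2 * b / (r * s2) * (orderSq x / (16 / 5)) ^ 2 :=
      mul_le_mul_of_nonneg_left hw (by positivity)
    have h3 : 1 + ρ - b = (A.card : ℝ) * (1 + b) / N - b := by rw [hρ]; ring
    rw [h3]
    linarith
  have hρr : r * (183 / 500 + 6 / 125 * r) ≤ ρ := by
    have h1 : 2 * b / (r * s2) * (r ^ 2 / (16 / 5)) ^ 2 ≤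
        r * (r / (1184 / 625) * (1 / 2 - 37 / 100 * r / 4)) := by
      rw [hs2', hb, div_mul_eq_mul_div, div_le_iff₀ (by
        exact mul_pos hr0 (mul_pos (by linarith) (by linarith)))]
      have h2 : r * (r / (1184 / 625) * (1 / 2 - 37 / 100 * r / 4)) *
          (r * (37 / 100 * r * (2 - 37 / 100 * r))) -
            2 * (1 - 37 / 100 * r) * (r ^ 2 / (16 / 5)) ^ 2 =
          r ^ 4 * (37 / 100 / (1184 / 625) / 4) * (37 / 100 * r) ^ 2 := by
        ring
      have h3 : 0 ≤ r ^ 4 * (37 / 100 / (1184 / 625) / 4) * (37 / 100 * r) ^ 2 := by positivity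
      linarith
    have h4 : r * r ≤ r * (1 + ρ - b + r / (1184 / 625) * (1 / 2 - 37 / 100 * r / 4)) := by
      linarith
    have h5 := le_of_mul_le_mul_left h4 hr0
    rw [hb] at h5
    nlinarith
  have hρ0 : 0 < ρ := lt_of_lt_of_le (by positivity) hρr
  have hsin : r ^ 2 / (8 / 5) ≤ 2 * √s2 * ρ := by
    have h1 : r / (8 / 5) / (2 * (183 / 500 + 6 / 125 * r)) ≤ √s2 := by
      apply Real.le_sqrt_of_sq_le
      rw [div_pow, div_le_iff₀ (by positivity), hs2']
      have h2 : r / (64 / 25) ≤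
          37 / 100 * (2 - 37 / 100 * r) * (2 * (183 / 500 + 6 / 125 * r)) ^ 2 := by
        nlinarith [mul_nonneg hr0.le (sub_nonneg.2 hr1),
          mul_nonneg (mul_nonneg hr0.le hr0.le) (sub_nonneg.2 hr1)]
      have h3 := mul_le_mul_of_nonneg_left h2 hr0.le
      linarith
    have h2 := mul_le_mul_of_nonneg_left hρr (Real.sqrt_nonneg s2)
    rw [div_le_iff₀ (by positivity)] at h1
    have h3 := mul_le_mul_of_nonneg_left h1 hr0.le
    linarith
  have hcos : Real.cos (Real.arccos b) = b := Real.cos_arccos (by linarith) hb1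
  refine ⟨fun i => round ((x i - φ) / (2 * Real.pi)), A, Real.arccos b, Real.arccos_nonneg b,
    Real.arccos_le_pi b, ?_, ?_, ?_, ?_⟩
  · by_contra hne
    rw [Finset.not_nonempty_iff_eq_empty] at hne
    norm_num [hρ, hne] at hρ0
  · rwa [hcos]
  · rwa [hcos, Real.sin_arccos, ← hru]
  · have hnear : ∀ i ∈ A, |x i - round ((x i - φ) / (2 * Real.pi)) * (2 * Real.pi) - φ| ≤
        Real.arccos b := by
      intro i hi
      have hi' : r * b ≤ meanCos x i := by simpa [hA] using hi
      rw [hrC] at hi'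
      have h1 := le_of_mul_le_mul_left hi' hr0
      set y := x i - round ((x i - φ) / (2 * Real.pi)) * (2 * Real.pi) - φ with hy
      have hpi := Real.two_pi_pos
      have hyb : |y| ≤ Real.pi := by
        have h2 := abs_sub_round ((x i - φ) / (2 * Real.pi))
        have h3 : y = ((x i - φ) / (2 * Real.pi) - round ((x i - φ) / (2 * Real.pi))) *
            (2 * Real.pi) := by
          rw [hy]
          field_simp
          ring
        rw [h3, abs_mul, abs_of_pos hpi]
        calc _ ≤ 1 / 2 * (2 * Real.pi) := mul_le_mul_of_nonneg_right h2 hpi.le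
          _ = Real.pi := by ring
      have h4 : Real.cos (x i - φ) = Real.cos |y| := by
        rw [Real.cos_abs, hy, sub_right_comm, Real.cos_sub_int_mul_two_pi]
      rw [h4] at h1
      rw [← Real.arccos_cos (abs_nonneg y) hyb]
      exact Real.arccos_le_arccos h1
    intro i hi j hj
    have h1 := abs_le.1 (hnear i hi)
    have h2 := abs_le.1 (hnear j hj)
    linarith

namespace IsKuramotoFlow

variable {N : ℕ} {κ : ℝ} {ν : Fin N → ℝ} {θ : ℝ → Fin N → ℝ}

/-- The order parameter grows until the mean of the squares of the `meanSin` becomes small. -/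
theorem exists_mean_sq_le (h : IsKuramotoFlow κ ν θ) (hN : 1 ≤ N) {D σ c m : ℝ}
    (hσ : 0 < σ) (hν : ∀ i, |ν i - m| ≤ D / 2) (hD : D < 2 * κ * σ) (h0 : c ≤ orderSq (θ 0)) :
    ∃ t, 0 ≤ t ∧ c ≤ orderSq (θ t) ∧ (∑ i, meanSin (θ t) i ^ 2) / N ≤ σ ^ 2 := by
  by_contra! hcon
  have hNpos : (0 : ℝ) < N := by exact_mod_cast hN
  have hD0 : 0 ≤ D := by linarith [(abs_nonneg _).trans (hν ⟨0, hN⟩)]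
  set η : ℝ := σ * (2 * κ * σ - D) with hη
  have hη0 : 0 < η := mul_pos hσ (by linarith)
  have hder : ∀ t, 0 ≤ t → c ≤ orderSq (θ t) →
      η ≤ 2 * ((∑ i, meanSin (θ t) i * (ν i + κ * meanSin (θ t) i)) / N) := by
    intro t ht hc
    have hw := hcon t ht hc
    set S := meanSin (θ t) with hS
    have h1 : ∀ i, (κ - D / (4 * σ)) * S i ^ 2 - D * σ / 4 ≤ S i * (ν i - m + κ * S i) := by
      intro i
      have h2 := abs_le.1 (hν i)
      have h3 : -(D / 2 * |S i|) ≤ S i * (ν i - m) := by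
        have h4 : |S i * (ν i - m)| ≤ |S i| * (D / 2) := by
          rw [abs_mul]
          exact mul_le_mul_of_nonneg_left (hν i) (abs_nonneg _)
        linarith [neg_abs_le (S i * (ν i - m))]
      have h5 : D / (4 * σ) * S i ^ 2 + D * σ / 4 - D / 2 * |S i| =
          D / (4 * σ) * (|S i| - σ) ^ 2 := by
        rw [← sq_abs (S i)]
        field_simp
        ring
      have h6 : 0 ≤ D / (4 * σ) * (|S i| - σ) ^ 2 := by positivity
      linarith
    have h2 := Finset.sum_le_sum fun i (_ : i ∈ Finset.univ) => h1 i
    have h3 : ∑ i, S i * (ν i - m + κ * S i) = ∑ i, S i * (ν i + κ * S i) := by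
      have h4 : ∀ i, S i * (ν i - m + κ * S i) = S i * (ν i + κ * S i) - m * S i := fun i => by
        ring
      simp only [h4, Finset.sum_sub_distrib, ← Finset.mul_sum]
      rw [hS, sum_meanSin, mul_zero, sub_zero]
    rw [h3, Finset.sum_sub_distrib, ← Finset.mul_sum] at h2
    simp only [Finset.sum_const, nsmul_eq_mul, Finset.card_univ, Fintype.card_fin] at h2
    have h4 := div_le_div_of_nonneg_right h2 hNpos.le
    rw [sub_div, mul_div_assoc, mul_div_cancel_left₀ _ hNpos.ne'] at h4
    have h5 : 0 ≤ κ - D / (4 * σ) := by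
      rw [sub_nonneg, div_le_iff₀ (by positivity)]
      linarith
    have h6 := mul_le_mul_of_nonneg_left hw.le h5
    have h7 : D / (4 * σ) * σ ^ 2 = D * σ / 4 := by
      field_simp
    rw [hη]
    linarith
  have hc : ∀ t, 0 ≤ t → c ≤ orderSq (θ t) := by
    intro t ht
    have := forall_le_of_deriv_neg_at_level (ι := Unit) (c := -c)
      (f := fun _ s => -orderSq (θ s)) (fun _ s hs => (h.hasDerivAt_orderSq hs).neg)
      (fun _ => by linarith)
      (fun s hs hle _ _ => by
        have h1 := hder s hs (by linarith [hle ()])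
        linarith) t ht ()
    linarith
  have hT : 0 < 2 / η := by positivity
  obtain ⟨ξ, hξ, hslope⟩ := exists_hasDerivAt_eq_slope _ _ hT
    (fun s hs => (h.continuousAt_orderSq hs.1).continuousWithinAt)
    (fun s hs => h.hasDerivAt_orderSq hs.1.le)
  have h1 := hder ξ hξ.1.le (hc ξ hξ.1.le)
  rw [hslope, sub_zero, le_div_iff₀ hT, mul_div_cancel₀ _ hη0.ne'] at h1
  linarith [orderSq_le_one (θ (2 / η)), orderSq_nonneg (θ 0)]

/-- If all phase differences stay bounded, the flow becomes stationary in the co-rotating frame. -/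
theorem tendsto_meanSin (h : IsKuramotoFlow κ ν θ) (hN : 1 ≤ N) (hκ : 0 < κ) {B : ℝ}
    (hB : ∀ t, 0 ≤ t → ∀ i j, |θ t i - θ t j| ≤ B) (i : Fin N) :
    Tendsto (fun t => meanSin (θ t) i) atTop (𝓝 (-(ν i - (∑ j, ν j) / N) / κ)) := by
  have hNpos : (0 : ℝ) < N := by exact_mod_cast hN
  set m := (∑ j, ν j) / N with hm
  have hsum : ∑ j, (ν j - m) = 0 := by
    rw [Finset.sum_sub_distrib, hm]
    simp only [Finset.sum_const, nsmul_eq_mul, Finset.card_univ, Fintype.card_fin]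
    field_simp
    ring
  set g : ℝ → Fin N → ℝ := fun t i => ν i - m + κ * meanSin (θ t) i with hg
  have hgsum : ∀ t, ∑ i, g t i = 0 := fun t => by
    rw [hg, Finset.sum_add_distrib, ← Finset.mul_sum, hsum, sum_meanSin, mul_zero, add_zero]
  set V := ∑ j, |ν j| with hV
  have hV0 : 0 ≤ V := Finset.sum_nonneg fun _ _ => abs_nonneg _
  have hνV : ∀ j, |ν j| ≤ V := fun j =>
    Finset.single_le_sum (f := fun k => |ν k|) (fun _ _ => abs_nonneg _) (Finset.mem_univ j)
  have hmV : |m| ≤ V := abs_sum_div_le hV0 hνV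
  have hκS : ∀ t j, |κ * meanSin (θ t) j| ≤ κ := fun t j => by
    rw [abs_mul, abs_of_pos hκ]
    exact mul_le_of_le_one_right hκ.le (abs_meanSin_le _ _)
  have hvel : ∀ t j, |ν j + κ * meanSin (θ t) j| ≤ V + κ := fun t j =>
    (abs_add_le _ _).trans (add_le_add (hνV j) (hκS t j))
  have hgb : ∀ t j, |g t j| ≤ 2 * V + κ := fun t j =>
    (abs_add_le _ _).trans (add_le_add ((abs_sub _ _).trans (by linarith [hνV j])) (hκS t j))
  have hgd : ∀ t, 0 ≤ t → ∀ j, ∃ d, |d| ≤ κ * (2 * (V + κ)) ∧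
      HasDerivAt (fun s => g s j) d t := by
    intro t ht j
    refine ⟨_, ?_, ((h.hasDerivAt_meanSin ht j).const_mul κ).const_add _⟩
    rw [abs_mul, abs_of_pos hκ]
    refine mul_le_mul_of_nonneg_left (abs_sum_div_le (by positivity) fun k => ?_) hκ.le
    rw [abs_mul]
    have h1 := (abs_sub (ν k + κ * meanSin (θ t) k) (ν j + κ * meanSin (θ t) j)).trans
      (add_le_add (hvel t k) (hvel t j))
    have h2 := mul_le_of_le_one_left (abs_nonneg
      (ν k + κ * meanSin (θ t) k - (ν j + κ * meanSin (θ t) j)))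
      (Real.abs_cos_le_one (θ t k - θ t j))
    linarith
  choose! d hdb hd using hgd
  have hP : Tendsto (fun t => (∑ j, g t j ^ 2) / N) atTop (𝓝 0) := by
    refine tendsto_deriv_zero_of_bddAbove
      (W := fun t => (∑ j, (ν j - m) * θ t j) / N + κ / 2 * orderSq (θ t))
      (B := 2 * V * B + κ / 2)
      (M := 2 * (2 * V + κ) * (κ * (2 * (V + κ)))) ?_ ?_ ?_ ?_
    · intro t ht
      have h1 : HasDerivAt (fun t => (∑ j, (ν j - m) * θ t j) / N)
          ((∑ j, (ν j - m) * (ν j + κ * meanSin (θ t) j)) / N) t :=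
        (HasDerivAt.fun_sum fun j _ => (h t ht j).const_mul _).div_const _
      refine (h1.add ((h.hasDerivAt_orderSq ht).const_mul (κ / 2))).congr_deriv ?_
      have h2 : ∀ j, (ν j - m) * (ν j + κ * meanSin (θ t) j) =
          g t j ^ 2 + m * g t j - κ * (meanSin (θ t) j * (ν j + κ * meanSin (θ t) j)) := by
        intro j
        rw [hg]
        ring
      simp only [h2, Finset.sum_add_distrib, Finset.sum_sub_distrib, ← Finset.mul_sum, hgsum]
      ring
    · intro t _
      positivity
    · intro t ht
      have h1 : ∑ j, (ν j - m) * θ t j = ∑ j, (ν j - m) * (θ t j - θ t i) := by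
        simp only [mul_sub, Finset.sum_sub_distrib (fun j => (ν j - m) * θ t j), ← Finset.sum_mul,
          hsum]
        ring
      have hB0 : 0 ≤ B := (abs_nonneg _).trans (hB t ht i i)
      have h2 : |(∑ j, (ν j - m) * (θ t j - θ t i)) / N| ≤ 2 * V * B := by
        refine abs_sum_div_le (by positivity) fun j => ?_
        rw [abs_mul]
        exact mul_le_mul ((abs_sub _ _).trans (by linarith [hνV j])) (hB t ht j i)
          (abs_nonneg _) (by positivity)
      simp only [h1]
      have h3 := mul_le_mul_of_nonneg_left (orderSq_le_one (θ t)) (half_pos hκ).le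
      linarith [(abs_le.1 h2).2]
    · intro s t hs hst
      have h1 : ∀ r ∈ Icc s t, HasDerivWithinAt (fun t => (∑ j, g t j ^ 2) / N)
          ((∑ j, 2 * g r j * d r j) / N) (Icc s t) r := by
        intro r hr
        have : HasDerivAt (fun t => (∑ j, g t j ^ 2) / N) _ r :=
          (HasDerivAt.fun_sum fun j _ => (hd r (hs.trans hr.1) j).pow 2).div_const _
        refine (this.congr_deriv ?_).hasDerivWithinAt
        simp
      have h2 := (convex_Icc s t).norm_image_sub_le_of_norm_hasDerivWithin_le h1
        (C := 2 * (2 * V + κ) * (κ * (2 * (V + κ)))) (fun r hr => by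
          refine abs_sum_div_le (by positivity) fun j => ?_
          rw [abs_mul, abs_mul, abs_two]
          exact mul_le_mul (mul_le_mul_of_nonneg_left (hgb r j) zero_le_two)
            (hdb r (hs.trans hr.1) j) (abs_nonneg _) (by positivity))
        (left_mem_Icc.2 hst) (right_mem_Icc.2 hst)
      rwa [Real.norm_eq_abs, Real.norm_eq_abs, abs_of_nonneg (sub_nonneg.2 hst)] at h2
  have hg2 : Tendsto (fun t => g t i ^ 2) atTop (𝓝 0) := by
    refine squeeze_zero (fun t => sq_nonneg _) (fun t => ?_)
      (by simpa using hP.const_mul (N : ℝ))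
    rw [mul_div_cancel₀ _ hNpos.ne']
    exact Finset.single_le_sum (f := fun j => g t j ^ 2) (fun _ _ => sq_nonneg _)
      (Finset.mem_univ i)
  have hg0 : Tendsto (fun t => g t i) atTop (𝓝 0) := by
    rw [tendsto_zero_iff_abs_tendsto_zero]
    have := (Real.continuous_sqrt.tendsto 0).comp hg2
    simpa [Function.comp_def, Real.sqrt_sq_eq_abs] using this
  have := (hg0.sub_const (ν i - m)).div_const κ
  rw [zero_sub] at this
  refine this.congr fun t => ?_
  rw [hg]
  field_simp
  ring

/-- If all phase differences stay bounded and the order parameter stays away from zero, then all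
phase differences converge. -/
theorem exists_tendsto_sub_of_bounded (h : IsKuramotoFlow κ ν θ) (hN : 1 ≤ N) (hκ : 0 < κ)
    {B δ : ℝ} (hB : ∀ t, 0 ≤ t → ∀ i j, |θ t i - θ t j| ≤ B) (hδ : 0 < δ)
    (hu : ∀ t, 0 ≤ t → δ ≤ orderSq (θ t)) (i j : Fin N) :
    ∃ L, Tendsto (fun t => θ t i - θ t j) atTop (𝓝 L) := by
  have hS := h.tendsto_meanSin hN hκ hB
  set s : Fin N → ℝ := fun i => -(ν i - (∑ j, ν j) / N) / κ with hs
  replace hS : ∀ i, Tendsto (fun t => meanSin (θ t) i) atTop (𝓝 (s i)) := hS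
  obtain ⟨u, hlim⟩ : ∃ u, Tendsto (fun t => orderSq (θ t)) atTop (𝓝 u) := by
    refine exists_tendsto_of_frequently_eq (B := 1) (fun t ht => h.continuousAt_orderSq ht)
      (fun t _ => by rw [abs_of_nonneg (orderSq_nonneg _)]; exact orderSq_le_one _) ?_
    intro a b hab
    by_contra! hcon
    have hsa : ∀ i, s i ^ 2 ≤ a := by
      intro i
      by_contra! hlt
      obtain ⟨v, hav, hv⟩ := exists_between (lt_min hlt hab)
      have hev := ((hS i).pow 2).eventually (lt_mem_nhds (hv.trans_le (min_le_left _ _)))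
      refine hcon v ⟨hav, hv.trans_le (min_le_right _ _)⟩ (hev.mono fun t ht heq => ?_)
      have := meanSin_sq_add_meanCos_sq (θ t) i
      nlinarith [sq_nonneg (meanCos (θ t) i)]
    obtain ⟨v, hv, hne⟩ := exists_forall_sign_ne hN (fun i => s i ^ 2) hab hsa
    have hev : ∀ᶠ t in atTop, ∀ ε : Fin N → Bool,
        (∑ i, (if ε i then 1 else -1) * √(v - meanSin (θ t) i ^ 2)) / N ≠ v := by
      refine eventually_all.2 fun ε => ?_
      have : Tendsto (fun t => (∑ i, (if ε i then 1 else -1) * √(v - meanSin (θ t) i ^ 2)) / N)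
          atTop (𝓝 ((∑ i, (if ε i then 1 else -1) * √(v - s i ^ 2)) / N)) :=
        (tendsto_finsetSum _ fun i _ =>
          (((hS i).pow 2).const_sub v).sqrt.const_mul _).div_const _
      exact this.eventually_ne (hne ε).symm
    refine hcon v hv (hev.mono fun t ht heq => ht (fun i => decide (0 ≤ meanCos (θ t) i)) ?_)
    rw [← heq]
    nth_rewrite 2 [← mean_meanCos]
    congr 1
    refine Finset.sum_congr rfl fun i _ => ?_
    have h1 : orderSq (θ t) - meanSin (θ t) i ^ 2 = meanCos (θ t) i ^ 2 := by
      rw [← meanSin_sq_add_meanCos_sq (θ t) i]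
      ring
    rw [h1, Real.sqrt_sq_eq_abs]
    by_cases hc : 0 ≤ meanCos (θ t) i
    · simp [hc, abs_of_nonneg hc]
    · simp [hc, abs_of_neg (not_le.1 hc)]
  have hu0 : u ≠ 0 :=
    (hδ.trans_le (ge_of_tendsto hlim ((eventually_ge_atTop 0).mono fun t ht => hu t ht))).ne'
  have hC : ∀ i, ∃ l, Tendsto (fun t => meanCos (θ t) i) atTop (𝓝 l) := by
    intro i
    refine exists_tendsto_of_tendsto_sq (B := 1) (L := u - s i ^ 2)
      (fun t ht => h.continuousAt_meanCos ht i) (fun t _ => abs_meanCos_le _ _) ?_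
    refine (hlim.sub ((hS i).pow 2)).congr fun t => ?_
    rw [← meanSin_sq_add_meanCos_sq (θ t) i]
    ring
  choose l hl using hC
  refine exists_tendsto_of_tendsto_cos (L := (l i * l j + s i * s j) / u)
    (fun t ht => (h.continuousAt ht i).sub (h.continuousAt ht j)) (fun t ht => hB t ht i j) ?_
  refine ((((hl i).mul (hl j)).add ((hS i).mul (hS j))).div hlim hu0).congr' ?_
  filter_upwards [eventually_ge_atTop 0] with t ht
  simp only [Pi.div_apply]
  rw [← cos_sub_mul_orderSq, mul_div_cancel_right₀ _ (hδ.trans_le (hu t ht)).ne']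

/-- Complete phase-locking holds as soon as the coupling strength exceeds `8 * D / (5 * r₀ ^ 2)`,
where `r₀` is the initial order parameter. -/
theorem exists_tendsto_sub (h : IsKuramotoFlow κ ν θ) (hN : 1 ≤ N) (hκ : 0 < κ) {D c m : ℝ}
    (hν : ∀ i, |ν i - m| ≤ D / 2) (hc : 0 < c) (hD : (8 / 5) * D < κ * c)
    (h0 : c ≤ orderSq (θ 0)) (i j : Fin N) :
    ∃ L, Tendsto (fun t => θ t i - θ t j) atTop (𝓝 L) := by
  obtain ⟨s, hs, hcs, hw⟩ := h.exists_mean_sq_le hN (σ := c / (16 / 5)) (by positivity) hν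
    (by linarith) h0
  have hus : 0 < orderSq (θ s) := hc.trans_le hcs
  obtain ⟨n, A, β, hβ0, hβ, hne, hρ, hDρ, hA⟩ := exists_cluster hN (θ s) hus
    (hw.trans (by gcongr))
  have hflow := h.comp_add_sub hs n
  have hνD : ∀ i j, ν i - ν j ≤ D := fun i j => by
    linarith [(abs_le.1 (hν i)).2, (abs_le.1 (hν j)).1]
  have hD' : D < κ * (2 * Real.sin β * ((A.card : ℝ) / N * (1 + Real.cos β) - 1)) := by
    have h1 : κ * (c / (8 / 5)) ≤ κ * (orderSq (θ s) / (8 / 5)) := by gcongr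
    have h2 := mul_le_mul_of_nonneg_left hDρ hκ.le
    linarith
  have hA0 : ∀ i ∈ A, ∀ j ∈ A, (θ (0 + s) i - n i * (2 * Real.pi)) -
      (θ (0 + s) j - n j * (2 * Real.pi)) ≤ 2 * β := by
    simpa only [zero_add] using hA
  obtain ⟨B, hB⟩ := hflow.exists_bound_of_cluster hN hκ hβ0 hβ hne hνD hD' hA0
  obtain ⟨L, hL⟩ := hflow.exists_tendsto_sub_of_bounded hN hκ hB (pow_pos hρ 2)
    (fun t ht => sq_le_orderSq_of_cluster _ hN hβ hρ.le
      (hflow.cluster_invariant hN hκ hβ0 hβ hνD hD' hA0 ht)) i j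
  refine ⟨L + (n i * (2 * Real.pi) - n j * (2 * Real.pi)), ?_⟩
  refine ((hL.comp (tendsto_atTop_add_const_right atTop (-s) tendsto_id)).add_const _).congr
    fun t => ?_
  simp only [Function.comp_apply, id_eq, neg_add_cancel_right]
  ring

end IsKuramotoFlow

section VolumeGrowth

open MeasureTheory

/-- First order lower bound for the determinant near the identity. -/
theorem exists_le_det_one_add (n : ℕ) {ε : ℝ} (hε : 0 < ε) :
    ∃ δ > 0, ∀ b, 0 ≤ b → b ≤ δ → ∀ X : Matrix (Fin n) (Fin n) ℝ, (∀ i j, |X i j| ≤ b) →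
      1 + X.trace - ε * b ≤ (1 + X).det := by
  set f : (Fin n → Fin n → ℝ) → ℝ := fun Y => (1 + Matrix.of Y).det with hf
  have hfd : Differentiable ℝ f := by
    simp only [hf, Matrix.det_apply, Matrix.add_apply, Matrix.of_apply]
    fun_prop
  obtain ⟨L, hL⟩ : ∃ L, HasFDerivAt f L 0 := ⟨_, (hfd 0).hasFDerivAt⟩
  have hLtr : ∀ Y, L Y = (Matrix.of Y).trace := by
    intro Y
    have h1 : HasDerivAt (fun r : ℝ => f (r • Y)) (L Y) 0 := by
      have h2 : HasDerivAt (fun r : ℝ => r • Y) Y 0 := by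
        simpa using (hasDerivAt_id (0 : ℝ)).smul_const Y
      have h3 : HasFDerivAt f L ((0 : ℝ) • Y) := by rwa [zero_smul]
      exact h3.comp_hasDerivAt 0 h2
    have h4 : HasDerivAt (fun r : ℝ => f (r • Y)) (Matrix.of Y).trace 0 := by
      have h5 : ∀ r : ℝ, f (r • Y) = 1 + (Matrix.of Y).trace * r + Polynomial.eval r
          (1 + (Polynomial.X : Polynomial ℝ) • (Matrix.of Y).map Polynomial.C).det.divX.divX *
            r ^ 2 := fun r => Matrix.det_one_add_smul r (Matrix.of Y)
      simp only [h5]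
      refine ((((hasDerivAt_id (0 : ℝ)).const_mul _).const_add 1).add
        ((Polynomial.hasDerivAt _ 0).mul (hasDerivAt_pow 2 0))).congr_deriv ?_
      simp
    exact h1.unique h4
  have h := (hasFDerivAt_iff_isLittleO_nhds_zero.1 hL).def hε
  rw [Metric.eventually_nhds_iff] at h
  obtain ⟨δ, hδ, h⟩ := h
  refine ⟨δ / 2, half_pos hδ, fun b hb0 hb X hX => ?_⟩
  have hn : ‖(fun i j => X i j : Fin n → Fin n → ℝ)‖ ≤ b :=
    (pi_norm_le_iff_of_nonneg hb0).2 fun i => (pi_norm_le_iff_of_nonneg hb0).2 fun j => hX i j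
  have h1 := h (y := fun i j => X i j) (by rw [dist_zero_right]; linarith)
  rw [hLtr, zero_add] at h1
  have h2 : f (fun i j => X i j) = (1 + X).det := rfl
  have h3 : f 0 = 1 := by
    have : f 0 = (1 + (0 : Matrix (Fin n) (Fin n) ℝ)).det := rfl
    rw [this, add_zero, Matrix.det_one]
  have h4 : (Matrix.of fun i j => X i j).trace = X.trace := rfl
  rw [h2, h3, h4, Real.norm_eq_abs] at h1
  have h5 := mul_le_mul_of_nonneg_left hn hε.le
  linarith [(abs_le.1 h1).1]

/-- An injective Lipschitz map whose Jacobian is at least `q` on `E` expands volumes in `E`. -/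
theorem mul_volume_le_volume_image {n : ℕ} {T : (Fin n → ℝ) → Fin n → ℝ} {K : NNReal}
    (hT : LipschitzWith K T) (hinj : Function.Injective T) {E : Set (Fin n → ℝ)} {q : ℝ}
    (hq : ∀ x ∈ E, DifferentiableAt ℝ T x → q ≤ |(fderiv ℝ T x).det|) {s : Set (Fin n → ℝ)}
    (hs : MeasurableSet s) (hsE : s ⊆ E) :
    ENNReal.ofReal q * volume s ≤ volume (T '' s) := by
  set d : Set (Fin n → ℝ) := {x | DifferentiableAt ℝ T x} with hd
  have hdm : MeasurableSet d := measurableSet_of_differentiableAt ℝ T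
  have hae : ∀ᵐ x ∂(volume : Measure (Fin n → ℝ)), x ∈ d := hT.ae_differentiableAt
  have h1 : volume (s ∩ d) = volume s :=
    measure_congr (inter_ae_eq_left_of_ae_eq_univ (eventuallyEq_univ.2 hae))
  calc ENNReal.ofReal q * volume s = ∫⁻ _ in s ∩ d, ENNReal.ofReal q := by
        rw [setLIntegral_const, h1]
    _ ≤ ∫⁻ x in s ∩ d, ENNReal.ofReal |(fderiv ℝ T x).det| :=
        setLIntegral_mono' (hs.inter hdm) fun x hx =>
          ENNReal.ofReal_le_ofReal (hq x (hsE hx.1) hx.2)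
    _ = volume (T '' (s ∩ d)) :=
        lintegral_abs_det_fderiv_eq_addHaar_image volume (hs.inter hdm)
          (fun x hx => hx.2.hasFDerivAt.hasFDerivWithinAt) hinj.injOn
    _ ≤ volume (T '' s) := measure_mono (image_mono inter_subset_left)

/-- A set which is mapped into itself by a volume-expanding map with bounded displacement is a null
set. -/
theorem volume_eq_zero_of_expanding {n : ℕ} {T : (Fin n → ℝ) → Fin n → ℝ} {E : Set (Fin n → ℝ)}
    (hE : MeasurableSet E) (hTE : MapsTo T E E) {M q : ℝ} (hM : 0 ≤ M) (hTM : ∀ x, dist (T x) x ≤ M)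
    (hq : 1 < q) (hexp : ∀ s, MeasurableSet s → s ⊆ E →
      ENNReal.ofReal q * volume s ≤ volume (T '' s)) :
    volume E = 0 := by
  have hq0 : 0 < q := by linarith
  have hgrow : ∀ (k : ℕ) (L : ℝ), ENNReal.ofReal (q ^ k) * volume (E ∩ Metric.closedBall 0 L) ≤
      volume (E ∩ Metric.closedBall 0 (L + k * M)) := by
    intro k
    induction k with
    | zero => intro L; simp
    | succ k ih =>
      intro L
      rw [pow_succ, ENNReal.ofReal_mul (by positivity), mul_assoc]
      have h1 : volume (T '' (E ∩ Metric.closedBall 0 L)) ≤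
          volume (E ∩ Metric.closedBall 0 (L + M)) := by
        refine measure_mono ?_
        rintro _ ⟨x, ⟨hxE, hxL⟩, rfl⟩
        refine ⟨hTE hxE, ?_⟩
        rw [Metric.mem_closedBall] at hxL ⊢
        linarith [dist_triangle (T x) x 0, hTM x]
      have h2 := (hexp _ (hE.inter measurableSet_closedBall) inter_subset_left).trans h1
      refine (mul_le_mul_right h2 _).trans ((ih (L + M)).trans (le_of_eq ?_))
      push_cast
      ring_nf
  have hball : ∀ L : ℕ, volume (E ∩ Metric.closedBall 0 (L : ℝ)) = 0 := by
    intro L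
    set m := volume (E ∩ Metric.closedBall (0 : Fin n → ℝ) (L : ℝ)) with hm
    have hmfin : m ≠ ⊤ := ((measure_mono inter_subset_right).trans_lt
      (isCompact_closedBall (0 : Fin n → ℝ) (L : ℝ)).measure_lt_top).ne
    have hbound : ∀ k : ℕ, m.toReal ≤
        (2 * (L + M)) ^ n * (((k + 1 : ℕ) : ℝ) ^ n / q ^ (k + 1)) := by
      intro k
      have h0 : (0 : ℝ) ≤ L + (k + 1 : ℕ) * M := by positivity
      have h1 := (hgrow (k + 1) L).trans (measure_mono inter_subset_right)
      rw [Real.volume_pi_closedBall _ h0, Fintype.card_fin] at h1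
      have h2 := ENNReal.toReal_mono ENNReal.ofReal_ne_top h1
      rw [ENNReal.toReal_mul, ENNReal.toReal_ofReal (by positivity),
        ENNReal.toReal_ofReal (by positivity)] at h2
      rw [← mul_div_assoc, le_div_iff₀ (by positivity), ← mul_pow, mul_comm]
      refine h2.trans (pow_le_pow_left₀ (by positivity) ?_ n)
      have h3 : (0 : ℝ) ≤ L * k := by positivity
      push_cast
      linarith
    have hlim : Tendsto (fun k : ℕ => (2 * (L + M)) ^ n * (((k + 1 : ℕ) : ℝ) ^ n / q ^ (k + 1)))
        atTop (𝓝 0) := by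
      have := ((tendsto_pow_const_div_const_pow_of_one_lt n hq).comp
        (tendsto_add_atTop_nat 1)).const_mul ((2 * (L + M)) ^ n)
      rwa [mul_zero] at this
    have h1 : m.toReal = 0 :=
      le_antisymm (ge_of_tendsto' hlim hbound) ENNReal.toReal_nonneg
    exact (ENNReal.toReal_eq_zero_iff m).1 h1 |>.resolve_right hmfin
  have hcover : E ⊆ ⋃ L : ℕ, E ∩ Metric.closedBall 0 (L : ℝ) := by
    intro x hx
    obtain ⟨L, hL⟩ := exists_nat_ge (dist x 0)
    exact mem_iUnion.2 ⟨L, hx, hL⟩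
  exact measure_mono_null hcover (measure_iUnion_null hball)

end VolumeGrowth

section Field

variable {N : ℕ}

/-- The Kuramoto vector field. -/
noncomputable def kuramotoField (κ : ℝ) (ν : Fin N → ℝ) (x : Fin N → ℝ) (i : Fin N) : ℝ :=
  ν i + κ * meanSin x i

theorem hasDerivAt_meanSin_comp {y : ℝ → Fin N → ℝ} {v : Fin N → ℝ} {t : ℝ}
    (hy : ∀ i, HasDerivAt (fun s => y s i) (v i) t) (i : Fin N) :
    HasDerivAt (fun s => meanSin (y s) i)
      ((∑ j, Real.cos (y t j - y t i) * (v j - v i)) / N) t :=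
  (HasDerivAt.fun_sum fun j _ => ((hy j).sub (hy i)).sin).div_const _

theorem abs_apply_sub_le_dist (x y : Fin N → ℝ) (i : Fin N) : |x i - y i| ≤ dist x y := by
  rw [← Real.dist_eq]
  exact dist_le_pi_dist x y i

theorem abs_sub_sub_sub_le_dist (x y : Fin N → ℝ) (i j : Fin N) :
    |(x j - x i) - (y j - y i)| ≤ 2 * dist x y := by
  have h1 := abs_apply_sub_le_dist x y i
  have h2 := abs_apply_sub_le_dist x y j
  have h3 := abs_sub (x j - y j) (x i - y i)
  rw [sub_sub_sub_comm]
  linarith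

theorem abs_mean_sub_mean_le {f g : Fin N → ℝ} {M : ℝ} (hM : 0 ≤ M)
    (h : ∀ j, |f j - g j| ≤ M) : |(∑ j, f j) / N - (∑ j, g j) / N| ≤ M := by
  rw [← sub_div, ← Finset.sum_sub_distrib]
  exact abs_sum_div_le hM h

theorem abs_sin_sub_sin_le (a b : ℝ) : |Real.sin a - Real.sin b| ≤ |a - b| := by
  simpa [Real.dist_eq] using Real.lipschitzWith_sin.dist_le_mul a b

theorem abs_cos_sub_cos_le (a b : ℝ) : |Real.cos a - Real.cos b| ≤ |a - b| := by
  simpa [Real.dist_eq] using Real.lipschitzWith_cos.dist_le_mul a b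

theorem abs_meanSin_sub_le (x y : Fin N → ℝ) (i : Fin N) :
    |meanSin x i - meanSin y i| ≤ 2 * dist x y :=
  abs_mean_sub_mean_le (by positivity) fun j =>
    (abs_sin_sub_sin_le _ _).trans (abs_sub_sub_sub_le_dist x y i j)

variable {κ : ℝ}

theorem abs_kuramotoField_sub_le (hκ : 0 ≤ κ) (ν x y : Fin N → ℝ) (i : Fin N) :
    |kuramotoField κ ν x i - kuramotoField κ ν y i| ≤ 2 * κ * dist x y := by
  have h := mul_le_mul_of_nonneg_left (abs_meanSin_sub_le x y i) hκ
  rw [kuramotoField, kuramotoField, add_sub_add_left_eq_sub, ← mul_sub, abs_mul, abs_of_nonneg hκ]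
  linarith

theorem abs_kuramotoField_le (hκ : 0 ≤ κ) (ν x : Fin N → ℝ) (i : Fin N) :
    |kuramotoField κ ν x i| ≤ ∑ j, |ν j| + κ := by
  refine (abs_add_le _ _).trans (add_le_add (Finset.single_le_sum (f := fun k => |ν k|)
    (fun _ _ => abs_nonneg _) (Finset.mem_univ i)) ?_)
  rw [abs_mul, abs_of_nonneg hκ]
  exact mul_le_of_le_one_right hκ (abs_meanSin_le _ _)

theorem lipschitzWith_kuramotoField (hκ : 0 ≤ κ) (ν : Fin N → ℝ) :
    LipschitzWith (2 * κ).toNNReal (kuramotoField κ ν) :=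
  LipschitzWith.of_dist_le_mul fun x y => by
    rw [Real.coe_toNNReal _ (by positivity)]
    exact (dist_pi_le_iff (by positivity)).2 fun i => abs_kuramotoField_sub_le hκ ν x y i

end Field

namespace IsKuramotoFlow

variable {N : ℕ} {κ : ℝ} {ν : Fin N → ℝ} {θ φ : ℝ → Fin N → ℝ}

theorem hasDerivAt (h : IsKuramotoFlow κ ν θ) {t : ℝ} (ht : 0 ≤ t) :
    HasDerivAt θ (kuramotoField κ ν (θ t)) t :=
  hasDerivAt_pi.2 fun i => h t ht i

theorem shift (h : IsKuramotoFlow κ ν θ) {s : ℝ} (hs : 0 ≤ s) :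
    IsKuramotoFlow κ ν fun t => θ (t + s) := by
  simpa using h.comp_add_sub hs 0

/-- A one-sided solution agrees for nonnegative times with a two-sided one. -/
theorem exists_of_hasDerivWithinAt
    (h : ∀ i, ∀ t, 0 ≤ t →
      HasDerivWithinAt (fun s => θ s i) (kuramotoField κ ν (θ t) i) (Ici 0) t) :
    ∃ φ, IsKuramotoFlow κ ν φ ∧ ∀ t, 0 ≤ t → φ t = θ t := by
  set φ : ℝ → Fin N → ℝ := fun t =>
    if 0 ≤ t then θ t else fun i => θ 0 i + t * kuramotoField κ ν (θ 0) i with hφ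
  have heq : ∀ t, 0 ≤ t → φ t = θ t := fun t ht => if_pos ht
  refine ⟨φ, fun t ht i => ?_, heq⟩
  have hpos : HasDerivWithinAt (fun s => φ s i) (kuramotoField κ ν (φ t) i) (Ici 0) t := by
    rw [heq t ht]
    exact (h i t ht).congr (fun s hs => by rw [heq s hs]) (by rw [heq t ht])
  rcases ht.eq_or_lt with rfl | ht'
  · have hlin : HasDerivAt (fun t => θ 0 i + t * kuramotoField κ ν (θ 0) i)
        (kuramotoField κ ν (θ 0) i) 0 := by
      simpa using ((hasDerivAt_id (0 : ℝ)).mul_const (kuramotoField κ ν (θ 0) i)).const_add (θ 0 i)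
    have hneg : HasDerivWithinAt (fun s => φ s i) (kuramotoField κ ν (φ 0) i) (Iic 0) 0 := by
      rw [heq 0 le_rfl]
      refine hlin.hasDerivWithinAt.congr (fun s hs => ?_) (by simp [heq 0 le_rfl])
      rcases (show s ≤ 0 from hs).eq_or_lt with rfl | hs'
      · simp [heq 0 le_rfl]
      · simp [hφ, not_le.2 hs']
    have := hneg.union hpos
    rwa [Iic_union_Ici, hasDerivWithinAt_univ] at this
  · exact hpos.hasDerivAt (Ici_mem_nhds ht')

theorem dist_le (hκ : 0 ≤ κ) (hθ : IsKuramotoFlow κ ν θ) (hφ : IsKuramotoFlow κ ν φ) {t : ℝ}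
    (ht : 0 ≤ t) : dist (θ t) (φ t) ≤ dist (θ 0) (φ 0) * Real.exp (2 * κ * t) := by
  have := dist_le_of_trajectories_ODE (v := fun _ => kuramotoField κ ν) (a := 0) (b := t)
    (fun _ => lipschitzWith_kuramotoField hκ ν)
    (fun s hs => (hθ.hasDerivAt hs.1).continuousAt.continuousWithinAt)
    (fun s hs => (hθ.hasDerivAt hs.1).hasDerivWithinAt)
    (fun s hs => (hφ.hasDerivAt hs.1).continuousAt.continuousWithinAt)
    (fun s hs => (hφ.hasDerivAt hs.1).hasDerivWithinAt) le_rfl t (right_mem_Icc.2 ht)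
  rwa [Real.coe_toNNReal _ (by positivity), sub_zero] at this

theorem eq_of_eq (hκ : 0 ≤ κ) (hθ : IsKuramotoFlow κ ν θ) (hφ : IsKuramotoFlow κ ν φ)
    (h0 : θ 0 = φ 0) {t : ℝ} (ht : 0 ≤ t) : θ t = φ t := by
  have := dist_le hκ hθ hφ ht
  rw [h0, dist_self, zero_mul] at this
  exact dist_le_zero.1 this

theorem dist_initial_le (hκ : 0 ≤ κ) (hθ : IsKuramotoFlow κ ν θ) {t : ℝ} (ht : 0 ≤ t) :
    dist (θ t) (θ 0) ≤ (∑ j, |ν j| + κ) * t := by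
  have hM : 0 ≤ ∑ j, |ν j| + κ := add_nonneg (Finset.sum_nonneg fun _ _ => abs_nonneg _) hκ
  have := (convex_Icc 0 t).norm_image_sub_le_of_norm_hasDerivWithin_le
    (fun s hs => (hθ.hasDerivAt hs.1).hasDerivWithinAt)
    (fun s _ => (pi_norm_le_iff_of_nonneg hM).2 fun i => abs_kuramotoField_le hκ ν (θ s) i)
    (left_mem_Icc.2 ht) (right_mem_Icc.2 ht)
  rwa [← dist_eq_norm, sub_zero, Real.norm_of_nonneg ht] at this

/-- The remainder of the Euler step depends on the initial condition in a Lipschitz way, with a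
constant which is quadratic in the step size. -/
theorem abs_euler_sub_le (hκ : 0 ≤ κ) (hθ : IsKuramotoFlow κ ν θ) (hφ : IsKuramotoFlow κ ν φ)
    {h : ℝ} (h0 : 0 ≤ h) (h1 : h ≤ 1) (i : Fin N) :
    |(θ h i - φ h i) - (θ 0 i - φ 0 i) -
        h * (kuramotoField κ ν (θ 0) i - kuramotoField κ ν (φ 0) i)| ≤
      κ * (4 * κ + 4 * (∑ j, |ν j| + κ)) * Real.exp (2 * κ) * h ^ 2 * dist (θ 0) (φ 0) := by
  set M := ∑ j, |ν j| + κ with hM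
  have hM0 : 0 ≤ M := add_nonneg (Finset.sum_nonneg fun _ _ => abs_nonneg _) hκ
  set F := kuramotoField κ ν with hF
  set C := κ * (4 * κ + 4 * M) * Real.exp (2 * κ) * dist (θ 0) (φ 0) with hC
  have hC0 : 0 ≤ C := by positivity
  have hd : ∀ s ∈ Icc 0 h, dist (θ s) (φ s) ≤ Real.exp (2 * κ) * dist (θ 0) (φ 0) := by
    intro s hs
    refine (dist_le hκ hθ hφ hs.1).trans ?_
    rw [mul_comm]
    refine mul_le_mul_of_nonneg_right (Real.exp_le_exp.2 ?_) dist_nonneg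
    exact mul_le_of_le_one_right (by positivity) (hs.2.trans h1)
  have hq : ∀ s ∈ Icc 0 h, |(F (θ s) i - F (φ s) i) - (F (θ 0) i - F (φ 0) i)| ≤ C * s := by
    intro s hs
    have hder : ∀ {ψ : ℝ → Fin N → ℝ}, IsKuramotoFlow κ ν ψ → ∀ r ∈ Icc 0 s,
        HasDerivAt (fun t => F (ψ t) i)
          (κ * ((∑ j, Real.cos (ψ r j - ψ r i) * (F (ψ r) j - F (ψ r) i)) / N)) r :=
      fun hψ r hr => ((hψ.hasDerivAt_meanSin hr.1 i).const_mul κ).const_add _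
    have := (convex_Icc 0 s).norm_image_sub_le_of_norm_hasDerivWithin_le
      (f := fun t => F (θ t) i - F (φ t) i) (C := C)
      (fun r hr => ((hder hθ r hr).sub (hder hφ r hr)).hasDerivWithinAt) (fun r hr => ?_)
      (left_mem_Icc.2 hs.1) (right_mem_Icc.2 hs.1)
    · rwa [sub_zero, Real.norm_eq_abs, Real.norm_of_nonneg hs.1] at this
    have hdr := hd r ⟨hr.1, hr.2.trans hs.2⟩
    rw [← mul_sub, Real.norm_eq_abs, abs_mul, abs_of_nonneg hκ]
    have hCe : C = κ * ((4 * κ + 4 * M) * (Real.exp (2 * κ) * dist (θ 0) (φ 0))) := by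
      rw [hC]; ring
    rw [hCe]
    refine mul_le_mul_of_nonneg_left ((abs_mean_sub_mean_le (by positivity) fun j => ?_).trans
      (mul_le_mul_of_nonneg_left hdr (by positivity))) hκ
    set a := θ r j - θ r i
    set b := φ r j - φ r i
    set u := F (θ r) j - F (θ r) i with hu
    set v := F (φ r) j - F (φ r) i with hv
    have hab : |a - b| ≤ 2 * dist (θ r) (φ r) := abs_sub_sub_sub_le_dist _ _ i j
    have huv : |u - v| ≤ 4 * κ * dist (θ r) (φ r) := by
      have e1 := abs_kuramotoField_sub_le hκ ν (θ r) (φ r) i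
      have e2 := abs_kuramotoField_sub_le hκ ν (θ r) (φ r) j
      have e3 := abs_sub (F (θ r) j - F (φ r) j) (F (θ r) i - F (φ r) i)
      rw [hu, hv, sub_sub_sub_comm]
      linarith
    have hvM : |v| ≤ 2 * M := by
      have e1 := abs_kuramotoField_le hκ ν (φ r) i
      have e2 := abs_kuramotoField_le hκ ν (φ r) j
      have e3 := abs_sub (F (φ r) j) (F (φ r) i)
      linarith
    have e1 : Real.cos a * u - Real.cos b * v =
        Real.cos a * (u - v) + (Real.cos a - Real.cos b) * v := by ring
    have e2 : |Real.cos a * (u - v)| ≤ |u - v| := by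
      rw [abs_mul]
      exact mul_le_of_le_one_left (abs_nonneg _) (Real.abs_cos_le_one _)
    have e3 : |(Real.cos a - Real.cos b) * v| ≤ 2 * dist (θ r) (φ r) * (2 * M) := by
      rw [abs_mul]
      exact mul_le_mul ((abs_cos_sub_cos_le a b).trans hab) hvM (abs_nonneg _) (by positivity)
    rw [e1]
    have e4 := abs_add_le (Real.cos a * (u - v)) ((Real.cos a - Real.cos b) * v)
    linarith
  have := (convex_Icc 0 h).norm_image_sub_le_of_norm_hasDerivWithin_le
    (f := fun t => (θ t i - φ t i) - t * (F (θ 0) i - F (φ 0) i)) (C := C * h)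
    (fun r hr => (((hθ r hr.1 i).sub (hφ r hr.1 i)).sub
      ((hasDerivAt_id r).mul_const (F (θ 0) i - F (φ 0) i))).hasDerivWithinAt) (fun r hr => ?_)
    (left_mem_Icc.2 h0) (right_mem_Icc.2 h0)
  · rw [sub_zero, Real.norm_eq_abs, Real.norm_of_nonneg h0, zero_mul, sub_zero,
      sub_right_comm] at this
    refine this.trans (le_of_eq ?_)
    rw [hC]
    ring
  · rw [one_mul]
    exact (hq r hr).trans (mul_le_mul_of_nonneg_left hr.2 hC0)

end IsKuramotoFlow

section FlowMap

open MeasureTheory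

variable {N : ℕ} {κ : ℝ} {ν : Fin N → ℝ} {Φ : (Fin N → ℝ) → ℝ → Fin N → ℝ}

theorem abs_kuramotoField_deriv_le (hκ : 0 ≤ κ) (x : Fin N → ℝ) (i j : Fin N) :
    |κ * ((∑ k, Real.cos (x k - x i) * ((Pi.single j 1 : Fin N → ℝ) k -
      (Pi.single j 1 : Fin N → ℝ) i)) / N)| ≤ κ := by
  rw [abs_mul, abs_of_nonneg hκ]
  refine mul_le_of_le_one_right hκ (abs_sum_div_le zero_le_one fun k => ?_)
  rw [abs_mul]
  refine mul_le_one₀ (Real.abs_cos_le_one _) (abs_nonneg _) ?_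
  simp only [Pi.single_apply]
  split_ifs <;> norm_num

theorem sum_kuramotoField_deriv (hN : 1 ≤ N) (x : Fin N → ℝ) :
    ∑ i, κ * ((∑ k, Real.cos (x k - x i) * ((Pi.single i 1 : Fin N → ℝ) k -
      (Pi.single i 1 : Fin N → ℝ) i)) / N) = κ * (1 - N * orderSq x) := by
  have hNpos : (0 : ℝ) < N := by exact_mod_cast hN
  have h1 : ∀ i, (∑ k, Real.cos (x k - x i) * ((Pi.single i 1 : Fin N → ℝ) k -
      (Pi.single i 1 : Fin N → ℝ) i)) / N = 1 / N - meanCos x i := by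
    intro i
    simp only [mul_sub, Finset.sum_sub_distrib, Pi.single_eq_same, mul_one, meanCos, sub_div]
    congr 2
    simp [Pi.single_apply]
  have h2 : ∑ i, meanCos x i = N * orderSq x := by
    rw [← mean_meanCos, mul_div_cancel₀ _ hNpos.ne']
  simp only [h1, ← Finset.mul_sum, Finset.sum_sub_distrib, h2]
  simp [hNpos.ne']

/-- For small times, the flow map is injective and expands volumes in the region where the order
parameter is small. -/
theorem exists_expanding_time (hN : 1 ≤ N) (hκ : 0 < κ) {c : ℝ} (hc : N * c < 1)
    (hΦ0 : ∀ x, Φ x 0 = x) (hΦ : ∀ x, IsKuramotoFlow κ ν (Φ x)) :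
    ∃ h q : ℝ, 0 < h ∧ 1 < q ∧ Function.Injective (fun x => Φ x h) ∧
      ∀ x, orderSq x ≤ c → DifferentiableAt ℝ (fun y => Φ y h) x →
        q ≤ |(fderiv ℝ (fun y => Φ y h) x).det| := by
  have hNpos : (0 : ℝ) < N := by exact_mod_cast hN
  set C := κ * (4 * κ + 4 * (∑ j, |ν j| + κ)) * Real.exp (2 * κ) with hC
  have hV : 0 ≤ ∑ j, |ν j| := Finset.sum_nonneg fun _ _ => abs_nonneg _
  have hC0 : 0 < C := by positivity
  set c₁ := κ * (1 - N * c) with hc₁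
  have hc₁0 : 0 < c₁ := mul_pos hκ (by linarith)
  obtain ⟨δ, hδ, hdet⟩ := exists_le_det_one_add N (ε := c₁ / (4 * (κ + C))) (by positivity)
  obtain ⟨h, hh0, hh1, hhδ, hhi, hhc⟩ : ∃ h : ℝ, 0 < h ∧ h ≤ 1 ∧ h * (κ + C) ≤ δ ∧
      h * (2 * κ + C) < 1 ∧ h * (N * C) ≤ c₁ / 4 := by
    have key : ∀ a b : ℝ, 0 < b → ∀ᶠ h in 𝓝[>] (0 : ℝ), h * a < b := by
      intro a b hb
      have : Tendsto (fun h : ℝ => h * a) (𝓝[>] 0) (𝓝 0) := by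
        have := (continuous_mul_const a).tendsto 0
        rw [zero_mul] at this
        exact this.mono_left nhdsWithin_le_nhds
      exact this.eventually (gt_mem_nhds hb)
    obtain ⟨h, h0, h1, h2, h3, h4⟩ := (eventually_mem_nhdsWithin.and
      ((key 1 1 one_pos).and ((key (κ + C) δ hδ).and
        ((key (2 * κ + C) 1 one_pos).and (key (N * C) (c₁ / 4) (by positivity)))))).exists
    exact ⟨h, h0, by linarith, h2.le, h3, h4.le⟩
  have hrem : ∀ x y i, |(Φ x h i - Φ y h i) - (x i - y i) -
      h * (kuramotoField κ ν x i - kuramotoField κ ν y i)| ≤ C * h ^ 2 * dist x y := by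
    intro x y i
    have := IsKuramotoFlow.abs_euler_sub_le hκ.le (hΦ x) (hΦ y) hh0.le hh1 i
    simpa only [hΦ0] using this
  have hh2 : C * h ^ 2 ≤ C * h :=
    mul_le_mul_of_nonneg_left (pow_le_of_le_one hh0.le hh1 two_ne_zero) hC0.le
  refine ⟨h, 1 + h * c₁ / 2, hh0, by linarith [mul_pos hh0 hc₁0], ?_, ?_⟩
  · intro x y hxy
    by_contra hne
    have hpos : 0 < dist x y := dist_pos.2 hne
    have h1 : dist x y ≤ h * (2 * κ + C) * dist x y := by
      refine (dist_pi_le_iff (by positivity)).2 fun i => ?_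
      have h2 := hrem x y i
      have h3 : Φ x h i = Φ y h i := congrFun hxy i
      have h4 := mul_le_mul_of_nonneg_left (abs_kuramotoField_sub_le hκ.le ν x y i) hh0.le
      have h5 := mul_le_mul_of_nonneg_right hh2 hpos.le
      rw [← abs_of_pos hh0, ← abs_mul, abs_of_pos hh0] at h4
      rw [h3, sub_self, zero_sub] at h2
      rw [Real.dist_eq]
      have h6 := abs_sub (-(x i - y i) - h * (kuramotoField κ ν x i - kuramotoField κ ν y i))
        (-(h * (kuramotoField κ ν x i - kuramotoField κ ν y i)))
      rw [sub_neg_eq_add, sub_add_cancel, abs_neg, abs_neg] at h6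
      linarith
    nlinarith
  · intro x hx hdiff
    set f' := fderiv ℝ (fun y => Φ y h) x with hf'
    set X : Matrix (Fin N) (Fin N) ℝ := LinearMap.toMatrix' (f' : (Fin N → ℝ) →ₗ[ℝ] Fin N → ℝ) - 1
      with hX
    have hdetX : (1 + X).det = f'.det := by
      rw [hX, add_sub_cancel, LinearMap.det_toMatrix']
    set a : Fin N → Fin N → ℝ := fun i j => κ * ((∑ k, Real.cos (x k - x i) *
      ((Pi.single j 1 : Fin N → ℝ) k - (Pi.single j 1 : Fin N → ℝ) i)) / N) with ha
    have hXa : ∀ i j, |X i j - h * a i j| ≤ C * h ^ 2 := by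
      intro i j
      set e : Fin N → ℝ := Pi.single j 1 with he
      have hline : HasDerivAt (fun s : ℝ => x + s • e) e 0 := by
        simpa using ((hasDerivAt_id (0 : ℝ)).smul_const e).const_add x
      have hlinei : ∀ k, HasDerivAt (fun s : ℝ => (x + s • e) k) (e k) 0 := hasDerivAt_pi.1 hline
      have hd1 : HasDerivAt (fun s : ℝ => Φ (x + s • e) h i) (f' e i) 0 := by
        have h1 : HasFDerivAt (fun y => Φ y h) f' (x + (0 : ℝ) • e) := by
          rw [zero_smul, add_zero]
          exact hdiff.hasFDerivAt
        exact hasDerivAt_pi.1 (h1.comp_hasDerivAt 0 hline) i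
      have hd2 : HasDerivAt (fun s : ℝ => kuramotoField κ ν (x + s • e) i) (a i j) 0 := by
        refine (((hasDerivAt_meanSin_comp hlinei i).const_mul κ).const_add _).congr_deriv ?_
        simp [ha, he]
      have hd3 := (hd1.sub (hlinei i)).sub (hd2.const_mul h)
      have hlip := hd3.le_of_lip' (C := C * h ^ 2) (by positivity) (Eventually.of_forall fun s => by
        have h1 := hrem (x + s • e) (x + (0 : ℝ) • e) i
        have h2 : dist (x + s • e) (x + (0 : ℝ) • e) = ‖s - 0‖ := by
          rw [dist_eq_norm, zero_smul, add_zero, add_sub_cancel_left, norm_smul, he,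
            Pi.norm_single]
          simp
        rw [h2] at h1
        refine (le_of_eq ?_).trans h1
        rw [Real.norm_eq_abs]
        congr 1
        simp only [Pi.sub_apply]
        ring)
      have hXe : X i j = f' e i - e i := by
        rw [hX, Matrix.sub_apply, LinearMap.toMatrix'_apply, Matrix.one_apply, he,
          Pi.single_apply]
        rfl
      rw [hXe]
      exact hlip
    have hb : ∀ i j, |X i j| ≤ h * (κ + C) := by
      intro i j
      have h1 := mul_le_mul_of_nonneg_left (abs_kuramotoField_deriv_le hκ.le x i j) hh0.le
      rw [← abs_of_pos hh0, ← abs_mul, abs_of_pos hh0] at h1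
      have h2 := abs_add_le (X i j - h * a i j) (h * a i j)
      rw [sub_add_cancel] at h2
      linarith [hXa i j]
    have htr : h * c₁ - N * (C * h ^ 2) ≤ X.trace := by
      have h1 : ∑ i, (h * a i i - C * h ^ 2) ≤ X.trace :=
        Finset.sum_le_sum fun i _ => by
          have := (abs_le.1 (hXa i i)).1
          rw [Matrix.diag_apply]
          linarith
      rw [Finset.sum_sub_distrib, ← Finset.mul_sum, ha, sum_kuramotoField_deriv hN x] at h1
      simp only [Finset.sum_const, nsmul_eq_mul, Finset.card_univ, Fintype.card_fin] at h1
      have h2 : h * c₁ ≤ h * (κ * (1 - N * orderSq x)) := by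
        rw [hc₁]
        gcongr
      linarith
    have h1 := hdet (h * (κ + C)) (by positivity) hhδ X hb
    rw [hdetX] at h1
    have h2 : c₁ / (4 * (κ + C)) * (h * (κ + C)) = h * c₁ / 4 := by
      field_simp
    have h3 := mul_le_mul_of_nonneg_left hhc hh0.le
    refine le_trans ?_ (le_abs_self _)
    linarith

/-- Almost every solution eventually has an order parameter whose square exceeds `c`, for any
`c < 1 / N`. -/
theorem ae_exists_lt_orderSq (hN : 1 ≤ N) (hκ : 0 < κ) {c : ℝ} (hc : N * c < 1)
    (hΦ0 : ∀ x, Φ x 0 = x) (hΦ : ∀ x, IsKuramotoFlow κ ν (Φ x)) :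
    ∀ᵐ x ∂(volume : Measure (Fin N → ℝ)), ∃ t, 0 ≤ t ∧ c < orderSq (Φ x t) := by
  obtain ⟨h, q, hh, hq, hinj, hdet⟩ := exists_expanding_time hN hκ hc hΦ0 hΦ
  have hlip : ∀ t, 0 ≤ t → LipschitzWith (Real.exp (2 * κ * t)).toNNReal fun x => Φ x t :=
    fun t ht => LipschitzWith.of_dist_le_mul fun x y => by
      have := IsKuramotoFlow.dist_le hκ.le (hΦ x) (hΦ y) ht
      rwa [hΦ0, hΦ0, mul_comm, ← Real.coe_toNNReal _ (Real.exp_pos _).le] at this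
  have hcont : Continuous (orderSq : (Fin N → ℝ) → ℝ) := by
    unfold orderSq
    fun_prop
  set E : Set (Fin N → ℝ) := {x | ∀ t, 0 ≤ t → orderSq (Φ x t) ≤ c} with hE
  have hEc : IsClosed E := by
    simp only [hE, ofPred_forall]
    exact isClosed_iInter fun t => isClosed_iInter fun ht =>
      isClosed_le (hcont.comp (hlip t ht).continuous) continuous_const
  have hmaps : MapsTo (fun x => Φ x h) E E := by
    intro x hx t ht
    have h1 : Φ (Φ x h) t = Φ x (t + h) :=
      IsKuramotoFlow.eq_of_eq hκ.le (hΦ _) ((hΦ x).shift hh.le) (by simp [hΦ0]) ht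
    rw [h1]
    exact hx _ (by positivity)
  have hnull : volume E = 0 := by
    refine volume_eq_zero_of_expanding hEc.measurableSet hmaps
      (M := (∑ j, |ν j| + κ) * h) ?_ (fun x => ?_) hq fun s hs hsE => ?_
    · have : 0 ≤ ∑ j, |ν j| := Finset.sum_nonneg fun _ _ => abs_nonneg _
      positivity
    · simpa only [hΦ0] using (hΦ x).dist_initial_le hκ.le hh.le
    · refine mul_volume_le_volume_image (hlip h hh.le) hinj (fun x hx hd => hdet x ?_ hd) hs hsE
      simpa only [hΦ0] using hx 0 le_rfl
  rw [ae_iff]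
  convert hnull using 2
  ext x
  simp [hE]

end FlowMap

theorem abs_sub_le_freqDiam {N : ℕ} (ν : Fin N → ℝ) (i j : Fin N) : |ν i - ν j| ≤ freqDiam ν := by
  refine le_csSup ?_ ⟨i, j, rfl⟩
  refine (Set.Finite.subset (Set.finite_range fun p : Fin N × Fin N => |ν p.1 - ν p.2|) ?_).bddAbove
  rintro _ ⟨i, j, rfl⟩
  exact ⟨(i, j), rfl⟩

theorem exists_abs_sub_le_half_freqDiam {N : ℕ} (hN : 1 ≤ N) (ν : Fin N → ℝ) :
    ∃ m, ∀ i, |ν i - m| ≤ freqDiam ν / 2 := by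
  have : Nonempty (Fin N) := ⟨⟨0, hN⟩⟩
  obtain ⟨a, ha⟩ := Finite.exists_max ν
  obtain ⟨b, hb⟩ := Finite.exists_min ν
  have h := (le_abs_self _).trans (abs_sub_le_freqDiam ν a b)
  refine ⟨(ν a + ν b) / 2, fun i => abs_le.2 ⟨?_, ?_⟩⟩
  · linarith [ha i, hb i]
  · linarith [ha i, hb i]

end Kuramoto

/-- Theorem 3.3 (1): if `κ > 1.6 N D(Ω)`, then for Lebesgue-almost every initial
phase vector `Θ⁰ ∈ ℝ^N` the Kuramoto flow starting at `Θ⁰` exhibits complete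
phase-locking: every pairwise phase difference converges to a finite limit. -/
theorem complete_phase_locking_ae (N : ℕ) (hN : 1 ≤ N) (κ : ℝ) (ν : Fin N → ℝ)
    (hκ : 1.6 * N * freqDiam ν < κ)
    (Φ : (Fin N → ℝ) → ℝ → Fin N → ℝ)
    (hΦ0 : ∀ Θ0 : Fin N → ℝ, Φ Θ0 0 = Θ0)
    (hΦ : ∀ Θ0 : Fin N → ℝ, IsKuramotoOn κ ν (Φ Θ0)) :
    ∀ᵐ Θ0 ∂(MeasureTheory.volume : MeasureTheory.Measure (Fin N → ℝ)),
      ∀ i j : Fin N, ∃ L : ℝ,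
        Filter.Tendsto (fun t => Φ Θ0 t i - Φ Θ0 t j) Filter.atTop (nhds L) := by
  have hNpos : (0 : ℝ) < N := by exact_mod_cast hN
  have hD0 : 0 ≤ freqDiam ν :=
    (abs_nonneg _).trans (abs_sub_le_freqDiam ν ⟨0, hN⟩ ⟨0, hN⟩)
  have hκ0 : 0 < κ := lt_of_le_of_lt (by positivity) hκ
  obtain ⟨m, hm⟩ := exists_abs_sub_le_half_freqDiam hN ν
  obtain ⟨c, hDc, hc⟩ : ∃ c, 8 / 5 * freqDiam ν / κ < c ∧ c < 1 / N := by
    refine exists_between ?_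
    rw [div_lt_div_iff₀ hκ0 hNpos]
    norm_num at hκ
    linarith
  have hc0 : 0 < c := lt_of_le_of_lt (by positivity) hDc
  rw [div_lt_iff₀ hκ0] at hDc
  rw [lt_div_iff₀ hNpos] at hc
  have hflow : ∀ x, ∃ φ, IsKuramotoFlow κ ν φ ∧ ∀ t, 0 ≤ t → φ t = Φ x t := by
    intro x
    refine IsKuramotoFlow.exists_of_hasDerivWithinAt fun i t ht => ?_
    have h1 := hΦ x i t ht
    rwa [div_mul_eq_mul_div, mul_div_assoc] at h1
  choose Ψ hΨ hΨΦ using hflow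
  filter_upwards [ae_exists_lt_orderSq hN hκ0 (by linarith)
    (fun x => (hΨΦ x 0 le_rfl).trans (hΦ0 x)) hΨ] with x ⟨s, hs, hu⟩ i j
  obtain ⟨L, hL⟩ := ((hΨ x).shift hs).exists_tendsto_sub hN hκ0 hm hc0 (by linarith)
    (by simpa using hu.le) i j
  refine ⟨L, ?_⟩
  refine (hL.comp (Filter.tendsto_atTop_add_const_right Filter.atTop (-s)
    Filter.tendsto_id)).congr' ?_
  filter_upwards [Filter.eventually_ge_atTop 0] with t ht
  simp only [Function.comp_apply, id_eq, neg_add_cancel_right, hΨΦ x t ht]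
end
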